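/- arXiv:0705.0252 — 8 statements merged into one kernel-verified Lean document; each statement's English description precedes it below -/
import Mathlib

section
/- Let the fading gains γ₁,…,γ_B be i.i.d. Nakagami-m power gains with parameter m > 0, and let μ be their product law on ℝ₊^B. For P > 0 define the minimal short-term outage probability P_out^opt(P) = μ{γ : sup{ Σ_{b=1}^B I_𝒳(p_b γ_b) : p ∈ ℝ₊^B, Σ_{b=1}^B p_b ≤ B·P } < B·R}. If 0 < R < M and B(1 − R/M) is not an integer, then lim_{P→∞} log P_out^opt(P) / log P = −m·d_B(R), where d_B(R) = 1 + ⌊B(1 − R/M)⌋ is the Singleton bound; that is, the SNR exponent of the optimal short-term power allocation scheme equals m times the Singleton bound. -/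
open MeasureTheory Finset

/-- AWGN input–output mutual information of constellation `𝒳` at SNR `ρ`. -/
noncomputable def mutualInfo (𝒳 : Finset ℂ) (ρ : ℝ) : ℝ :=
  Real.logb 2 𝒳.card -
    (𝒳.card : ℝ)⁻¹ * ∑ x ∈ 𝒳, ∫ z : ℂ,
      (Real.pi⁻¹ * Real.exp (-‖z‖ ^ 2)) *
        Real.logb 2 (∑ x' ∈ 𝒳, Real.exp (-‖(Real.sqrt ρ : ℂ) * (x - x') + z‖ ^ 2 + ‖z‖ ^ 2))

/-- Law of a Nakagami-m power fading gain: density `m^m γ^{m−1} e^{−mγ}/Γ(m)` for `γ ≥ 0`. -/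
noncomputable def nakagamiMeasure (m : ℝ) : Measure ℝ :=
  volume.withDensity fun γ =>
    ENNReal.ofReal (if 0 ≤ γ then m ^ m * γ ^ (m - 1) * Real.exp (-m * γ) / Real.Gamma m else 0)

lemma aux_int (b : ℝ) (hb : 0 < b) : Integrable (fun z : ℂ => Real.exp (-b * ‖z‖ ^ 2)) := by
  have h := (GaussianFourier.integrable_cexp_neg_mul_sq_norm_add (V := ℂ) (b := (b:ℂ)) (by simpa using hb) 0 0).norm
  refine h.congr (Filter.Eventually.of_forall fun z => ?_)
  simp only [Complex.norm_exp]
  norm_num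
  left
  norm_cast

noncomputable def mI (𝒳 : Finset ℂ) (x : ℂ) (s : ℝ) (z : ℂ) : ℝ :=
  (Real.pi⁻¹ * Real.exp (-‖z‖ ^ 2)) *
        Real.logb 2 (∑ x' ∈ 𝒳, Real.exp (-‖(s : ℂ) * (x - x') + z‖ ^ 2 + ‖z‖ ^ 2))

lemma mI_sum_ge (𝒳 : Finset ℂ) (x : ℂ) (hx : x ∈ 𝒳) (s : ℝ) (z : ℂ) :
    1 ≤ ∑ x' ∈ 𝒳, Real.exp (-‖(s : ℂ) * (x - x') + z‖ ^ 2 + ‖z‖ ^ 2) := by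
  have := Finset.single_le_sum (f := fun x' => Real.exp (-‖(s : ℂ) * (x - x') + z‖ ^ 2 + ‖z‖ ^ 2))
    (fun i _ => (Real.exp_pos _).le) hx
  simpa using this

lemma mI_nonneg (𝒳 : Finset ℂ) (x : ℂ) (hx : x ∈ 𝒳) (s : ℝ) (z : ℂ) : 0 ≤ mI 𝒳 x s z := by
  have := Real.logb_nonneg (b := 2) (by norm_num) (mI_sum_ge 𝒳 x hx s z)
  unfold mI
  positivity

noncomputable def mIbd (𝒳 : Finset ℂ) (z : ℂ) : ℝ :=
  (Real.pi⁻¹ * Real.logb 2 𝒳.card) * Real.exp (-1 * ‖z‖ ^ 2) +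
    (Real.pi⁻¹ * (2 / Real.log 2)) * Real.exp (-(1/2) * ‖z‖ ^ 2)

lemma mIbd_int (𝒳 : Finset ℂ) : Integrable (mIbd 𝒳) :=
  ((aux_int 1 (by norm_num)).const_mul _).add ((aux_int (1/2) (by norm_num)).const_mul _)

lemma mI_le (𝒳 : Finset ℂ) (x : ℂ) (hx : x ∈ 𝒳) (s : ℝ) (z : ℂ) : ‖mI 𝒳 x s z‖ ≤ mIbd 𝒳 z := by
  rw [Real.norm_of_nonneg (mI_nonneg 𝒳 x hx s z)]
  have h1 := mI_sum_ge 𝒳 x hx s z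
  have hc : (0:ℝ) < 𝒳.card := by exact_mod_cast Finset.card_pos.2 ⟨x, hx⟩
  have h2 : ∑ x' ∈ 𝒳, Real.exp (-‖(s : ℂ) * (x - x') + z‖ ^ 2 + ‖z‖ ^ 2)
      ≤ 𝒳.card * Real.exp (‖z‖ ^ 2) := by
    rw [← nsmul_eq_mul]
    apply Finset.sum_le_card_nsmul
    intro i _
    apply Real.exp_le_exp.2
    have := sq_nonneg ‖(s : ℂ) * (x - i) + z‖
    linarith
  have hl : 0 < Real.log 2 := Real.log_pos (by norm_num)
  have h3 : Real.logb 2 (∑ x' ∈ 𝒳, Real.exp (-‖(s : ℂ) * (x - x') + z‖ ^ 2 + ‖z‖ ^ 2))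
      ≤ Real.logb 2 𝒳.card + ‖z‖ ^ 2 / Real.log 2 := by
    calc _ ≤ Real.logb 2 (𝒳.card * Real.exp (‖z‖ ^ 2)) :=
          Real.logb_le_logb_of_le (by norm_num) (by linarith) h2
      _ = _ := by
          rw [Real.logb_mul hc.ne' (Real.exp_pos _).ne']
          simp [Real.logb]
  have h4 : Real.exp (-‖z‖ ^ 2) * ‖z‖ ^ 2 ≤ 2 * Real.exp (-(1/2) * ‖z‖ ^ 2) := by
    have e1 : Real.exp (-‖z‖ ^ 2) = Real.exp (-(1/2) * ‖z‖ ^ 2) * Real.exp (-(‖z‖ ^ 2 / 2)) := by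
      rw [← Real.exp_add]; congr 1; ring
    have e2 : ‖z‖ ^ 2 / 2 ≤ Real.exp (‖z‖ ^ 2 / 2) := by
      have := Real.add_one_le_exp (‖z‖ ^ 2 / 2); linarith
    have e3 : Real.exp (-(‖z‖ ^ 2 / 2)) * (‖z‖ ^ 2 / 2) ≤ 1 := by
      rw [Real.exp_neg, inv_mul_le_iff₀ (Real.exp_pos _)]; linarith
    rw [e1]
    nlinarith [Real.exp_pos (-(1/2) * ‖z‖ ^ 2)]
  have hp := Real.pi_pos
  calc mI 𝒳 x s z ≤ (Real.pi⁻¹ * Real.exp (-‖z‖ ^ 2)) * (Real.logb 2 𝒳.card + ‖z‖ ^ 2 / Real.log 2) := by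
        unfold mI; gcongr
    _ = (Real.pi⁻¹ * Real.logb 2 𝒳.card) * Real.exp (-1 * ‖z‖ ^ 2) +
         (Real.pi⁻¹ / Real.log 2) * (Real.exp (-‖z‖ ^ 2) * ‖z‖ ^ 2) := by
        rw [show -1 * ‖z‖^2 = -‖z‖^2 by ring]; ring
    _ ≤ (Real.pi⁻¹ * Real.logb 2 𝒳.card) * Real.exp (-1 * ‖z‖ ^ 2) +
         (Real.pi⁻¹ / Real.log 2) * (2 * Real.exp (-(1/2) * ‖z‖ ^ 2)) := by gcongr
    _ = _ := by unfold mIbd; ring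

lemma mI_cont (𝒳 : Finset ℂ) (x : ℂ) (hx : x ∈ 𝒳) : Continuous (fun q : ℝ × ℂ => mI 𝒳 x q.1 q.2) := by
  unfold mI Real.logb
  refine Continuous.mul (by fun_prop) (Continuous.div_const (Continuous.log (by fun_prop) ?_) _)
  intro q
  have := mI_sum_ge 𝒳 x hx q.1 q.2
  linarith

lemma mutualInfo_eq (𝒳 : Finset ℂ) (ρ : ℝ) : mutualInfo 𝒳 ρ = Real.logb 2 𝒳.card -
    (𝒳.card : ℝ)⁻¹ * ∑ x ∈ 𝒳, ∫ z : ℂ, mI 𝒳 x (Real.sqrt ρ) z := rfl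

lemma mutualInfo_le (𝒳 : Finset ℂ) (ρ : ℝ) : mutualInfo 𝒳 ρ ≤ Real.logb 2 𝒳.card := by
  rw [mutualInfo_eq]
  have : 0 ≤ (𝒳.card : ℝ)⁻¹ * ∑ x ∈ 𝒳, ∫ z : ℂ, mI 𝒳 x (Real.sqrt ρ) z :=
    mul_nonneg (by positivity) (Finset.sum_nonneg fun x hx => integral_nonneg (mI_nonneg 𝒳 x hx _))
  linarith

lemma mutualInfo_zero (𝒳 : Finset ℂ) (h : 𝒳.Nonempty) : mutualInfo 𝒳 0 = 0 := by
  rw [mutualInfo_eq]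
  have hc : (𝒳.card : ℝ) ≠ 0 := by exact_mod_cast (Finset.card_pos.2 h).ne'
  have : ∀ x ∈ 𝒳, ∫ z : ℂ, mI 𝒳 x (Real.sqrt 0) z = Real.logb 2 𝒳.card := by
    intro x _
    have e : ∀ z, mI 𝒳 x (Real.sqrt 0) z = (Real.pi⁻¹ * Real.logb 2 𝒳.card) * Real.exp (-1 * ‖z‖ ^ 2) := by
      intro z; simp [mI]; ring
    simp_rw [e]
    rw [integral_const_mul, GaussianFourier.integral_rexp_neg_mul_sq_norm (V := ℂ) (by norm_num)]
    have := Real.pi_ne_zero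
    simp
    field_simp
  rw [Finset.sum_congr rfl this]
  simp
  field_simp
  simp

lemma mutualInfo_cont (𝒳 : Finset ℂ) : Continuous (mutualInfo 𝒳) := by
  have : ∀ x ∈ 𝒳, Continuous (fun ρ : ℝ => ∫ z : ℂ, mI 𝒳 x (Real.sqrt ρ) z) := by
    intro x hx
    refine continuous_of_dominated (bound := mIbd 𝒳) ?_ ?_ (mIbd_int 𝒳) ?_
    · intro ρ
      exact ((mI_cont 𝒳 x hx).comp (by fun_prop : Continuous fun z : ℂ => (Real.sqrt ρ, z))).aestronglyMeasurable
    · intro ρ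
      exact Filter.Eventually.of_forall fun z => mI_le 𝒳 x hx _ z
    · exact Filter.Eventually.of_forall fun z =>
        (mI_cont 𝒳 x hx).comp (by fun_prop : Continuous fun ρ : ℝ => (Real.sqrt ρ, z))
  have e : mutualInfo 𝒳 = fun ρ => Real.logb 2 𝒳.card -
    (𝒳.card : ℝ)⁻¹ * ∑ x ∈ 𝒳, ∫ z : ℂ, mI 𝒳 x (Real.sqrt ρ) z := rfl
  rw [e]
  exact continuous_const.sub (continuous_const.mul (continuous_finsetSum _ this))

lemma mI_tendsto (𝒳 : Finset ℂ) (x : ℂ) (hx : x ∈ 𝒳) (z : ℂ) :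
    Filter.Tendsto (fun ρ : ℝ => mI 𝒳 x (Real.sqrt ρ) z) Filter.atTop (nhds 0) := by
  have key : Filter.Tendsto (fun ρ : ℝ => ∑ x' ∈ 𝒳,
      Real.exp (-‖((Real.sqrt ρ : ℝ) : ℂ) * (x - x') + z‖ ^ 2 + ‖z‖ ^ 2)) Filter.atTop
      (nhds (∑ x' ∈ 𝒳, if x' = x then 1 else 0)) := by
    apply tendsto_finsetSum
    intro x' _
    split_ifs with h
    · subst h; simp
    · apply Real.tendsto_exp_atBot.comp
      apply Filter.tendsto_atBot_add_const_right
      apply Filter.tendsto_neg_atTop_atBot.comp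
      apply (Filter.tendsto_pow_atTop two_ne_zero).comp
      have hp : 0 < ‖x - x'‖ := norm_pos_iff.2 (sub_ne_zero.2 (Ne.symm h))
      have h1 : Filter.Tendsto (fun ρ : ℝ => Real.sqrt ρ * ‖x - x'‖ + (-‖z‖)) Filter.atTop Filter.atTop :=
        Filter.tendsto_atTop_add_const_right _ _ (Real.tendsto_sqrt_atTop.atTop_mul_const hp)
      refine Filter.tendsto_atTop_mono (fun ρ => ?_) h1
      have := norm_sub_norm_le (((Real.sqrt ρ : ℝ) : ℂ) * (x - x')) (-z)
      rw [sub_neg_eq_add, norm_neg, norm_mul, Complex.norm_real,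
        Real.norm_of_nonneg (Real.sqrt_nonneg ρ)] at this
      linarith
  have e : (∑ x' ∈ 𝒳, if x' = x then (1:ℝ) else 0) = 1 := by simp [hx]
  rw [e] at key
  have := ((key.log one_ne_zero).div_const (Real.log 2)).const_mul (Real.pi⁻¹ * Real.exp (-‖z‖ ^ 2))
  simpa [mI, Real.logb] using this

lemma mutualInfo_tendsto (𝒳 : Finset ℂ) :
    Filter.Tendsto (mutualInfo 𝒳) Filter.atTop (nhds (Real.logb 2 𝒳.card)) := by
  have : ∀ x ∈ 𝒳, Filter.Tendsto (fun ρ : ℝ => ∫ z : ℂ, mI 𝒳 x (Real.sqrt ρ) z) Filter.atTop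
      (nhds (∫ _ : ℂ, (0:ℝ))) := by
    intro x hx
    refine tendsto_integral_filter_of_dominated_convergence (mIbd 𝒳) ?_ ?_ (mIbd_int 𝒳) ?_
    · refine Filter.Eventually.of_forall fun ρ => ?_
      exact ((mI_cont 𝒳 x hx).comp (by fun_prop : Continuous fun z : ℂ => (Real.sqrt ρ, z))).aestronglyMeasurable
    · refine Filter.Eventually.of_forall fun ρ => ?_
      exact Filter.Eventually.of_forall fun z => mI_le 𝒳 x hx _ z
    · exact Filter.Eventually.of_forall fun z => mI_tendsto 𝒳 x hx z
  have h := ((tendsto_finsetSum 𝒳 this).const_mul (𝒳.card : ℝ)⁻¹).const_sub (Real.logb 2 𝒳.card)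
  simp only [integral_zero, Finset.sum_const_zero, mul_zero, sub_zero] at h
  exact h

lemma nak_prob (m : ℝ) (hm : 0 < m) : IsProbabilityMeasure (nakagamiMeasure m) := by
  have e : nakagamiMeasure m = ProbabilityTheory.gammaMeasure m m := by
    unfold nakagamiMeasure ProbabilityTheory.gammaMeasure
    congr 1
    funext x
    rw [ProbabilityTheory.gammaPDF_eq]
    congr 1
    split_ifs
    · rw [neg_mul]; ring
    · rfl
  rw [e]
  exact ProbabilityTheory.isProbabilityMeasure_gammaMeasure hm hm

lemma lint_rpow (m : ℝ) (hm : 0 < m) (t : ℝ) (ht : 0 < t) (K : ℝ) (hK : 0 ≤ K) :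
    ∫⁻ x in Set.Icc 0 t, ENNReal.ofReal (K * x ^ (m - 1)) = ENNReal.ofReal (K / m * t ^ m) := by
  rw [← ofReal_integral_eq_lintegral_ofReal]
  · congr 1
    rw [integral_Icc_eq_integral_Ioc, ← intervalIntegral.integral_of_le ht.le,
      intervalIntegral.integral_const_mul, integral_rpow (Or.inl (by linarith))]
    simp [Real.zero_rpow hm.ne']
    ring
  · change IntegrableOn (fun x => K * x ^ (m - 1)) (Set.Icc 0 t) volume
    rw [integrableOn_Icc_iff_integrableOn_Ioc, ← intervalIntegrable_iff_integrableOn_Ioc_of_le ht.le]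
    exact (intervalIntegral.intervalIntegrable_rpow' (by linarith)).const_mul _
  · refine (ae_restrict_iff' measurableSet_Icc).2 (Filter.Eventually.of_forall fun x hx => ?_)
    exact mul_nonneg hK (Real.rpow_nonneg hx.1 _)

lemma nak_cdf (m : ℝ) (hm : 0 < m) : ∃ c₁ c₂ : ℝ, 0 < c₁ ∧ 0 < c₂ ∧ ∀ t : ℝ, 0 < t → t ≤ 1 →
    c₁ * t ^ m ≤ (nakagamiMeasure m).real (Set.Iic t) ∧
    (nakagamiMeasure m).real (Set.Iic t) ≤ c₂ * t ^ m := by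
  have hG := Real.Gamma_pos_of_pos hm
  have hmm : 0 < m ^ m := Real.rpow_pos_of_pos hm m
  have := nak_prob m hm
  refine ⟨m ^ m / Real.Gamma m * Real.exp (-m) / m, m ^ m / Real.Gamma m / m, by positivity, by positivity, ?_⟩
  intro t ht ht1
  have e : nakagamiMeasure m (Set.Iic t) = ∫⁻ x in Set.Icc 0 t, ENNReal.ofReal
      (m ^ m * x ^ (m - 1) * Real.exp (-m * x) / Real.Gamma m) := by
    unfold nakagamiMeasure
    rw [withDensity_apply _ measurableSet_Iic, lintegral_Iic_eq_lintegral_Iio_add_Icc _ ht.le]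
    rw [setLIntegral_congr_fun (g := fun _ ↦ 0) measurableSet_Iio, lintegral_zero, zero_add]
    · refine setLIntegral_congr_fun measurableSet_Icc fun x hx => ?_
      simp only [if_pos hx.1]
    · intro x hx
      have hx' : x < 0 := hx
      simp only [if_neg (not_le.2 hx'), ENNReal.ofReal_zero]
  constructor
  · have : ENNReal.ofReal (m ^ m / Real.Gamma m * Real.exp (-m) / m * t ^ m) ≤ nakagamiMeasure m (Set.Iic t) := by
      rw [e, ← lint_rpow m hm t ht _ (by positivity)]
      refine setLIntegral_mono' measurableSet_Icc fun x hx => ENNReal.ofReal_le_ofReal ?_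
      have h1 : Real.exp (-m) ≤ Real.exp (-m * x) := Real.exp_le_exp.2 (by nlinarith [hx.2])
      have h2 := Real.rpow_nonneg hx.1 (m - 1)
      calc _ = m ^ m * x ^ (m - 1) * Real.exp (-m) / Real.Gamma m := by ring
        _ ≤ _ := by gcongr
    exact (ENNReal.ofReal_le_iff_le_toReal (measure_ne_top _ _)).1 this
  · apply ENNReal.toReal_le_of_le_ofReal (by positivity)
    rw [e, ← lint_rpow m hm t ht _ (by positivity)]
    refine setLIntegral_mono' measurableSet_Icc fun x hx => ENNReal.ofReal_le_ofReal ?_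
    have h1 : Real.exp (-m * x) ≤ 1 := Real.exp_le_one_iff.2 (by nlinarith [hx.1])
    have h2 := Real.rpow_nonneg hx.1 (m - 1)
    calc _ ≤ m ^ m * x ^ (m - 1) * 1 / Real.Gamma m := by gcongr
      _ = _ := by ring

lemma pi_box (m : ℝ) (hm : 0 < m) (B : ℕ) (S : Finset (Fin B)) (t : ℝ) :
    (Measure.pi fun _ : Fin B => nakagamiMeasure m).real {γ | ∀ b ∈ S, γ b ≤ t} =
      ((nakagamiMeasure m).real (Set.Iic t)) ^ S.card := by
  have := nak_prob m hm
  have e : {γ : Fin B → ℝ | ∀ b ∈ S, γ b ≤ t} =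
      Set.pi Set.univ (fun b => if b ∈ S then Set.Iic t else Set.univ) := by
    ext γ
    simp only [Set.mem_ofPred_eq, Set.mem_pi, Set.mem_univ, true_imp_iff]
    refine forall_congr' fun b => ?_
    by_cases h : b ∈ S <;> simp [h]
  rw [e, Measure.real, Measure.pi_pi, ENNReal.toReal_prod]
  have : ∀ b : Fin B, (nakagamiMeasure m (if b ∈ S then Set.Iic t else Set.univ)).toReal =
      if b ∈ S then (nakagamiMeasure m).real (Set.Iic t) else 1 := by
    intro b; split_ifs <;> simp [Measure.real]
  simp_rw [this]
  simp [Finset.prod_ite_mem]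

lemma log_lim (Q : ℝ → ℝ) (a c₁ c₂ P₀ : ℝ) (h1 : 0 < c₁) (h2 : 0 < c₂)
    (hl : ∀ P, P₀ ≤ P → c₁ * P ^ a ≤ Q P) (hu : ∀ P, P₀ ≤ P → Q P ≤ c₂ * P ^ a) :
    Filter.Tendsto (fun P => Real.log (Q P) / Real.log P) Filter.atTop (nhds a) := by
  have key : ∀ c : ℝ, Filter.Tendsto (fun P : ℝ => Real.log c / Real.log P + a) Filter.atTop (nhds a) := by
    intro c
    simpa using (Real.tendsto_log_atTop.const_div_atTop (Real.log c)).add_const a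
  refine tendsto_of_tendsto_of_tendsto_of_le_of_le' (key c₁) (key c₂) ?_ ?_
  all_goals
    filter_upwards [Filter.eventually_ge_atTop P₀, Filter.eventually_gt_atTop 1] with P hP hP1
    have hp : 0 < P := by linarith
    have hlog : 0 < Real.log P := Real.log_pos hP1
    have hpa : 0 < P ^ a := Real.rpow_pos_of_pos hp a
    have e : ∀ c, 0 < c → Real.log c / Real.log P + a = Real.log (c * P ^ a) / Real.log P := by
      intro c hc
      rw [Real.log_mul hc.ne' hpa.ne', Real.log_rpow hp]; field_simp
    have hQ : 0 < Q P := lt_of_lt_of_le (by positivity) (hl P hP)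
  · rw [e _ h1]
    have := Real.log_le_log (by positivity) (hl P hP)
    gcongr
  · rw [e _ h2]
    have := Real.log_le_log hQ (hu P hP)
    gcongr

/-- for i.i.d. Nakagami-m power fading gains and `0 < R < M` with `B(1−R/M)`
not an integer, the SNR exponent of the minimal short-term outage probability equals
`m·d_B(R)` where `d_B(R) = 1 + ⌊B(1−R/M)⌋` is the Singleton bound. -/
theorem shortTerm_optimal_SNR_exponent_Singleton
    (B M : ℕ) (hB : 1 ≤ B) (𝒳 : Finset ℂ) (h𝒳 : 𝒳.card = 2 ^ M)
    (m : ℝ) (hm : 0 < m) (R : ℝ) (hR : 0 < R) (hRM : R < M)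
    (hnotint : ∀ k : ℤ, (B : ℝ) * (1 - R / M) ≠ (k : ℝ)) :
    Filter.Tendsto
      (fun P : ℝ =>
        Real.log ((Measure.pi fun _ : Fin B => nakagamiMeasure m)
          {γ | sSup {I : ℝ | ∃ p : Fin B → ℝ, (∀ b, 0 ≤ p b) ∧ ∑ b, p b ≤ (B : ℝ) * P ∧
                  ∑ b, mutualInfo 𝒳 (p b * γ b) = I} < (B : ℝ) * R}).toReal
          / Real.log P)
      Filter.atTop
      (nhds (-(m * (1 + (⌊(B : ℝ) * (1 - R / (M : ℝ))⌋ : ℝ))))) := by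
  classical
  have hprob := nak_prob m hm
  have hBr : (0:ℝ) < B := by exact_mod_cast hB
  have hM : (0:ℝ) < M := hR.trans hRM
  have hcard : Real.logb 2 𝒳.card = M := by
    rw [h𝒳]; push_cast
    rw [← Real.rpow_natCast, Real.logb_rpow (by norm_num) (by norm_num)]
  have hne : 𝒳.Nonempty := Finset.card_pos.1 (by rw [h𝒳]; positivity)
  have hle : ∀ ρ, mutualInfo 𝒳 ρ ≤ M := fun ρ => hcard ▸ mutualInfo_le 𝒳 ρ
  set v : ℝ := (B : ℝ) * (1 - R / M) with hv
  have hv0 : 0 ≤ v := by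
    have : R / M ≤ 1 := (div_le_one hM).2 hRM.le
    exact mul_nonneg hBr.le (by linarith)
  have hvB : v < B := by
    have : 0 < R / M := div_pos hR hM
    nlinarith
  obtain ⟨k, hk⟩ := Int.eq_ofNat_of_zero_le (Int.floor_nonneg.2 hv0)
  have hk1 : (k : ℝ) < v := by
    have h := Int.floor_le v
    have h' := hnotint k
    rw [hk] at h
    push_cast at h h'
    exact lt_of_le_of_ne h (Ne.symm h')
  have hk2 : v < k + 1 := by
    have h := Int.lt_floor_add_one v
    rw [hk] at h
    exact_mod_cast h
  have hkB : k + 1 ≤ B := by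
    have : (k : ℝ) < B := hk1.trans hvB
    exact_mod_cast this
  have hvM : v * M = B * M - B * R := by rw [hv]; field_simp
  rw [hk]
  have hbdd : ∀ (P : ℝ) (γ : Fin B → ℝ), ∀ I ∈ {I : ℝ | ∃ p : Fin B → ℝ, (∀ b, 0 ≤ p b) ∧
      ∑ b, p b ≤ (B : ℝ) * P ∧ ∑ b, mutualInfo 𝒳 (p b * γ b) = I}, I ≤ B * M := by
    rintro P γ I ⟨p, -, -, rfl⟩
    calc _ ≤ ∑ _b : Fin B, (M:ℝ) := Finset.sum_le_sum fun b _ => hle _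
      _ = _ := by simp
  -- large SNR threshold
  obtain ⟨T, hT0, hT⟩ : ∃ T : ℝ, 0 < T ∧ ∀ ρ, T ≤ ρ → (B:ℝ) * R ≤ (B - k : ℝ) * mutualInfo 𝒳 ρ := by
    have h1 : Filter.Tendsto (fun ρ => (B - k : ℝ) * mutualInfo 𝒳 ρ) Filter.atTop
        (nhds ((B - k : ℝ) * M)) := by
      have := (mutualInfo_tendsto 𝒳).const_mul (B - k : ℝ)
      rwa [hcard] at this
    have h2 : (B:ℝ) * R < (B - k : ℝ) * M := by nlinarith
    obtain ⟨T, hT⟩ := Filter.eventually_atTop.1 (h1.eventually (lt_mem_nhds h2))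
    exact ⟨max T 1, by positivity, fun ρ hρ => (hT ρ ((le_max_left _ _).trans hρ)).le⟩
  -- small SNR threshold
  obtain ⟨δ, hδ0, hδ⟩ : ∃ δ : ℝ, 0 < δ ∧ ∀ ρ, ρ ≤ δ →
      (k + 1 : ℝ) * mutualInfo 𝒳 ρ ≤ ((k + 1 - v) * M) / 2 := by
    have h1 : Filter.Tendsto (fun ρ => (k + 1 : ℝ) * mutualInfo 𝒳 ρ) (nhds 0) (nhds 0) := by
      have := ((mutualInfo_cont 𝒳).tendsto 0).const_mul (k + 1 : ℝ)
      rwa [mutualInfo_zero 𝒳 hne, mul_zero] at this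
    have h2 : 0 < ((k + 1 - v) * M) / 2 := by
      have : 0 < k + 1 - v := by linarith
      positivity
    obtain ⟨ε, hε, h3⟩ := Metric.eventually_nhds_iff.1 (h1.eventually (gt_mem_nhds h2))
    refine ⟨ε / 2, by positivity, fun ρ hρ => ?_⟩
    rcases le_or_gt ρ 0 with h | h
    · have : mutualInfo 𝒳 ρ = mutualInfo 𝒳 0 := by
        simp only [mutualInfo, Real.sqrt_eq_zero_of_nonpos h, Real.sqrt_zero]
      rw [this, mutualInfo_zero 𝒳 hne, mul_zero]
      exact h2.le
    · refine (h3 ?_).le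
      rw [Real.dist_eq, sub_zero, abs_of_pos h]
      linarith
  obtain ⟨c₁, c₂, hc₁, hc₂, hF⟩ := nak_cdf m hm
  -- upper inclusion
  have hup : ∀ P : ℝ, 0 < P →
      {γ : Fin B → ℝ | sSup {I : ℝ | ∃ p : Fin B → ℝ, (∀ b, 0 ≤ p b) ∧ ∑ b, p b ≤ (B : ℝ) * P ∧
                  ∑ b, mutualInfo 𝒳 (p b * γ b) = I} < (B : ℝ) * R} ⊆
      ⋃ S ∈ Finset.powersetCard (k + 1) (Finset.univ : Finset (Fin B)),
        {γ : Fin B → ℝ | ∀ b ∈ S, γ b ≤ T / P} := by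
    intro P hP γ hγ
    rw [Set.mem_ofPred_eq] at hγ
    by_contra hcon
    refine absurd hγ (not_lt.2 ?_)
    set S : Finset (Fin B) := Finset.univ.filter fun b => γ b ≤ T / P with hS
    have hScard : S.card ≤ k := by
      by_contra hlt
      obtain ⟨S', hS', hS'c⟩ := Finset.exists_subset_card_eq (show k + 1 ≤ S.card by omega)
      apply hcon
      refine Set.mem_biUnion (x := S') (by simpa using hS'c) ?_
      intro b hb
      exact (Finset.mem_filter.1 (hS' hb)).2
    have hcS : B - k ≤ Sᶜ.card := by
      rw [Finset.card_compl, Fintype.card_fin]; omega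
    obtain ⟨G, hG, hGc⟩ := Finset.exists_subset_card_eq hcS
    have hGcr : (G.card : ℝ) = B - k := by rw [hGc, Nat.cast_sub (by omega)]
    have hposk : (0:ℝ) < B - k := by
      have : ((k + 1 : ℕ) : ℝ) ≤ B := by exact_mod_cast hkB
      push_cast at this; linarith
    refine le_trans ?_ (le_csSup ⟨B * M, hbdd P γ⟩
      ⟨fun b => if b ∈ G then P else 0, fun b => by dsimp only; split_ifs <;> positivity, ?_, rfl⟩)
    · have e : ∀ b, mutualInfo 𝒳 ((if b ∈ G then P else 0) * γ b) =
          if b ∈ G then mutualInfo 𝒳 (P * γ b) else 0 := by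
        intro b; split_ifs <;> simp [mutualInfo_zero 𝒳 hne]
      simp_rw [e]
      rw [Finset.sum_ite_mem, Finset.univ_inter]
      have hb : ∀ b ∈ G, (B:ℝ) * R / (B - k) ≤ mutualInfo 𝒳 (P * γ b) := by
        intro b hb
        rw [div_le_iff₀' hposk]
        apply hT
        have := hG hb
        simp only [hS, Finset.mem_compl, Finset.mem_filter, Finset.mem_univ, true_and, not_le] at this
        rw [div_lt_iff₀' hP] at this
        exact this.le
      have := Finset.card_nsmul_le_sum G _ _ hb
      rw [nsmul_eq_mul, hGcr, mul_div_cancel₀ _ hposk.ne'] at this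
      exact this
    · calc _ ≤ ∑ _b : Fin B, P := Finset.sum_le_sum fun b _ => by split_ifs <;> linarith
        _ = _ := by simp
  -- lower inclusion
  obtain ⟨S₀, -, hS₀⟩ := Finset.exists_subset_card_eq
    (show k + 1 ≤ (Finset.univ : Finset (Fin B)).card by simpa using hkB)
  have hlow : ∀ P : ℝ, 0 < P →
      {γ : Fin B → ℝ | ∀ b ∈ S₀, γ b ≤ δ / B / P} ⊆
      {γ : Fin B → ℝ | sSup {I : ℝ | ∃ p : Fin B → ℝ, (∀ b, 0 ≤ p b) ∧ ∑ b, p b ≤ (B : ℝ) * P ∧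
                  ∑ b, mutualInfo 𝒳 (p b * γ b) = I} < (B : ℝ) * R} := by
    intro P hP γ hγ
    rw [Set.mem_ofPred_eq] at hγ ⊢
    have hlt : ((k + 1 - v) * M) / 2 + (B - (k + 1)) * M < B * R := by nlinarith
    refine lt_of_le_of_lt (csSup_le ⟨_, ⟨0, fun _ => le_rfl, by simp; positivity, rfl⟩⟩ ?_) hlt
    rintro I ⟨p, hp0, hps, rfl⟩
    rw [← Finset.sum_add_sum_compl S₀]
    have h1 : ∑ b ∈ S₀, mutualInfo 𝒳 (p b * γ b) ≤ ((k + 1 - v) * M) / 2 := by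
      have hk0 : (0:ℝ) < k + 1 := by positivity
      have := Finset.sum_le_card_nsmul S₀ (fun b => mutualInfo 𝒳 (p b * γ b))
        (((k + 1 - v) * M) / 2 / (k + 1)) (fun b hb => by
          rw [le_div_iff₀' hk0]
          apply hδ
          have hpb : p b ≤ B * P :=
            (Finset.single_le_sum (fun i _ => hp0 i) (Finset.mem_univ b)).trans hps
          calc p b * γ b ≤ p b * (δ / B / P) := mul_le_mul_of_nonneg_left (hγ b hb) (hp0 b)
            _ ≤ (B * P) * (δ / B / P) := by gcongr
            _ = δ := by field_simp)
      rw [hS₀, nsmul_eq_mul] at this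
      push_cast at this
      rwa [mul_div_cancel₀ _ hk0.ne'] at this
    have h2 : ∑ b ∈ S₀ᶜ, mutualInfo 𝒳 (p b * γ b) ≤ (B - (k + 1)) * M := by
      have := Finset.sum_le_card_nsmul S₀ᶜ (fun b => mutualInfo 𝒳 (p b * γ b)) M (fun b _ => hle _)
      rw [Finset.card_compl, Fintype.card_fin, hS₀, nsmul_eq_mul, Nat.cast_sub hkB] at this
      push_cast at this
      exact this
    linarith
  have hpow : ∀ (c a P : ℝ), 0 < c → 0 < a → 0 < P → (c * (a / P) ^ m) ^ (k + 1) =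
      (c * a ^ m) ^ (k + 1) * P ^ (-(m * (1 + (k : ℝ)))) := by
    intro c a P hc ha hP
    rw [Real.div_rpow ha.le hP.le, ← mul_div_assoc, div_pow, Real.rpow_neg hP.le, div_eq_mul_inv,
      ← Real.rpow_natCast (P ^ m), ← Real.rpow_mul hP.le]
    push_cast
    rw [add_comm (k:ℝ) 1]
  have hgoal := log_lim (fun P : ℝ => ((Measure.pi fun _ : Fin B => nakagamiMeasure m)
          {γ | sSup {I : ℝ | ∃ p : Fin B → ℝ, (∀ b, 0 ≤ p b) ∧ ∑ b, p b ≤ (B : ℝ) * P ∧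
                  ∑ b, mutualInfo 𝒳 (p b * γ b) = I} < (B : ℝ) * R}).toReal)
    (-(m * (1 + (k : ℝ)))) ((c₁ * (δ / B) ^ m) ^ (k + 1))
    ((B.choose (k + 1)) * (c₂ * T ^ m) ^ (k + 1)) (max T (δ / B)) (by positivity)
    (by have := Nat.choose_pos hkB; positivity) ?_ ?_
  · simpa using hgoal
  · intro P hP
    have hP1 : δ / B ≤ P := (le_max_right _ _).trans hP
    have hP0 : 0 < P := hT0.trans_le ((le_max_left _ _).trans hP)
    rw [← hpow c₁ (δ / B) P hc₁ (by positivity) hP0]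
    have h := measureReal_mono (μ := Measure.pi fun _ : Fin B => nakagamiMeasure m) (hlow P hP0)
    rw [pi_box m hm, hS₀] at h
    refine le_trans ?_ h
    have := (hF (δ / B / P) (by positivity) ((div_le_one hP0).2 hP1)).1
    gcongr
  · intro P hP
    have hP1 : T ≤ P := (le_max_left _ _).trans hP
    have hP0 : 0 < P := hT0.trans_le hP1
    rw [mul_assoc, ← hpow c₂ T P hc₂ hT0 hP0]
    have h := measureReal_mono (μ := Measure.pi fun _ : Fin B => nakagamiMeasure m) (hup P hP0)
      (measure_ne_top _ _)
    refine h.trans ((measureReal_biUnion_finset_le _ _).trans ?_)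
    have hb := (hF (T / P) (by positivity) ((div_le_one hP0).2 hP1)).2
    have := Finset.sum_le_card_nsmul (Finset.powersetCard (k + 1) (Finset.univ : Finset (Fin B)))
      (fun S => (Measure.pi fun _ : Fin B => nakagamiMeasure m).real {γ | ∀ b ∈ S, γ b ≤ T / P})
      ((c₂ * (T / P) ^ m) ^ (k + 1)) (fun S hS => by
        rw [pi_box m hm, (Finset.mem_powersetCard.1 hS).2]
        gcongr)
    rw [Finset.card_powersetCard, nsmul_eq_mul, Finset.card_univ, Fintype.card_fin] at this
    exact this
end

section
/- Fix β > 0, P > 0 and γ₁,…,γ_B > 0, and let I^tw(ρ) = log₂(1+ρ) for 0 ≤ ρ ≤ β and I^tw(ρ) = log₂(1+β) for ρ > β. Define p^tw ∈ ℝ₊^B as follows: if Σ_{b=1}^B β/γ_b ≤ B·P, set p^tw_b = β/γ_b for all b; otherwise set p^tw_b = min{β/γ_b, (η − 1/γ_b)₊}, where x₊ = max{x,0} and η > 0 is chosen so that Σ_{b=1}^B min{β/γ_b, (η − 1/γ_b)₊} = B·P. Then p^tw attains the maximum of Σ_{b=1}^B I^tw(p_b γ_b) over the constraint set {p ∈ ℝ₊^B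 : Σ_{b=1}^B p_b ≤ B·P}. -/
open Finset

/-- Truncated water-filling surrogate of the mutual information with truncation level `β`:
`log₂(1+ρ)` for `ρ ≤ β` and `log₂(1+β)` otherwise. -/
noncomputable def Itw (β ρ : ℝ) : ℝ :=
  if ρ ≤ β then Real.logb 2 (1 + ρ) else Real.logb 2 (1 + β)

theorem Itw_eq_aux (β ρ : ℝ) : Itw β ρ = Real.log (1 + min ρ β) / Real.log 2 := by
  unfold Itw Real.logb
  split_ifs with h
  · rw [min_eq_left h]
  · rw [min_eq_right (le_of_not_ge h)]

theorem log_tangent_aux (x y : ℝ) (hx : 0 ≤ x) (hy : 0 ≤ y) :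
    Real.log (1 + x) ≤ Real.log (1 + y) + (x - y) / (1 + y) := by
  have h := Real.log_le_sub_one_of_pos (x := (1 + x) / (1 + y)) (by positivity)
  rw [Real.log_div (by positivity) (by positivity)] at h
  have : (1 + x) / (1 + y) - 1 = (x - y) / (1 + y) := by field_simp; ring
  linarith

theorem slope_aux (β η g p : ℝ) (hβ : 0 < β) (hη : 0 < η) (hg : 0 < g) (hp : 0 ≤ p)
    (q : ℝ) (hq : q = min (β / g) (max (η - 1 / g) 0)) :
    (min (p * g) β - q * g) * η ≤ (p - q) * (1 + q * g) := by
  have hx1 := min_le_left (p * g) β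
  have hx2 := min_le_right (p * g) β
  have hbg : β / g * g = β := by field_simp
  have hbg0 : 0 < β / g := by positivity
  have h1g : 1 / g * g = 1 := by field_simp
  rcases le_total (β / g) (max (η - 1 / g) 0) with h | h
  · rw [min_eq_left h] at hq
    have h' : β / g ≤ η - 1 / g := by
      rcases le_max_iff.1 h with h | h
      · exact h
      · linarith
    have h2 : 1 + β ≤ η * g := by nlinarith
    have h3 : q * g = β := by rw [hq, hbg]
    rw [h3]
    rcases le_total (p * g) β with h4 | h4
    · rw [min_eq_left h4]
      have : p ≤ q := by rw [hq, le_div_iff₀ hg]; exact h4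
      have e : p * g - β = (p - q) * g := by rw [← h3]; ring
      rw [e]
      nlinarith
    · rw [min_eq_right h4]
      have : q ≤ p := by rw [hq, div_le_iff₀ hg]; exact h4
      have : 0 ≤ (p - q) * (1 + β) := mul_nonneg (by linarith) (by linarith)
      linarith
  · rw [min_eq_right h] at hq
    rcases le_total (η - 1 / g) 0 with h5 | h5
    · rw [max_eq_right h5] at hq
      subst hq
      have : η * g ≤ 1 := by nlinarith
      have : min (p * g) β * η ≤ p * g * η := mul_le_mul_of_nonneg_right hx1 hη.le
      nlinarith
    · rw [max_eq_left h5] at hq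
      have e : 1 + q * g = η * g := by rw [hq, sub_mul, h1g]; ring
      rw [e]
      have : (min (p * g) β - q * g) * η ≤ (p * g - q * g) * η :=
        mul_le_mul_of_nonneg_right (by linarith) hη.le
      linarith

/-- the truncated water-filling allocation (allocate `β/γ_b` everywhere if the
budget allows, otherwise `min{β/γ_b, (η − 1/γ_b)₊}` with water level `η` meeting the budget
with equality) maximizes `∑ I^tw(p_b γ_b)` over `{p ∈ ℝ₊^B : ∑ p_b ≤ B·P}`. -/
theorem truncated_waterfilling_maximizes_Itw
    (B : ℕ) (hB : 1 ≤ B) (β P : ℝ) (hβ : 0 < β) (hP : 0 < P)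
    (γ : Fin B → ℝ) (hγ : ∀ b, 0 < γ b) (η : ℝ)
    (hη : ¬ (∑ b, β / γ b ≤ (B : ℝ) * P) →
      0 < η ∧ ∑ b, min (β / γ b) (max (η - 1 / γ b) 0) = (B : ℝ) * P)
    (ptw : Fin B → ℝ)
    (hptw : ptw = if ∑ b, β / γ b ≤ (B : ℝ) * P then (fun b => β / γ b)
      else fun b => min (β / γ b) (max (η - 1 / γ b) 0)) :
    (∀ b, 0 ≤ ptw b) ∧ (∑ b, ptw b ≤ (B : ℝ) * P) ∧
    ∀ p : Fin B → ℝ, (∀ b, 0 ≤ p b) → ∑ b, p b ≤ (B : ℝ) * P →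
      ∑ b, Itw β (p b * γ b) ≤ ∑ b, Itw β (ptw b * γ b) := by
  have hl2 : 0 < Real.log 2 := Real.log_pos (by norm_num)
  by_cases hc : ∑ b, β / γ b ≤ (B : ℝ) * P
  · rw [if_pos hc] at hptw
    subst hptw
    refine ⟨fun b => (div_pos hβ (hγ b)).le, hc, fun p hp _ => Finset.sum_le_sum fun b _ => ?_⟩
    have e : β / γ b * γ b = β := div_mul_cancel₀ _ (hγ b).ne'
    simp only [Itw_eq_aux, e, min_self]
    have h0 : 0 ≤ min (p b * γ b) β := le_min (mul_nonneg (hp b) (hγ b).le) hβ.le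
    have := Real.log_le_log (x := 1 + min (p b * γ b) β) (y := 1 + β) (by linarith)
      (by linarith [min_le_right (p b * γ b) β])
    gcongr
  · obtain ⟨hη0, hs⟩ := hη hc
    rw [if_neg hc] at hptw
    have hs' : ∑ b, ptw b = (B : ℝ) * P := by rw [hptw]; exact hs
    have hq : ∀ b, ptw b = min (β / γ b) (max (η - 1 / γ b) 0) := fun b => by rw [hptw]
    have hq0 : ∀ b, 0 ≤ ptw b := fun b => by
      rw [hq]; exact le_min (div_pos hβ (hγ b)).le (le_max_right _ _)
    refine ⟨hq0, hs'.le, fun p hp hps => ?_⟩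
    have key : ∀ b, Itw β (p b * γ b) ≤
        Itw β (ptw b * γ b) + (p b - ptw b) * (1 / (η * Real.log 2)) := fun b => by
      have hle : ptw b * γ b ≤ β := by
        rw [← le_div_iff₀ (hγ b), hq]; exact min_le_left _ _
      have hy : 0 ≤ ptw b * γ b := mul_nonneg (hq0 b) (hγ b).le
      have h0 : 0 ≤ min (p b * γ b) β := le_min (mul_nonneg (hp b) (hγ b).le) hβ.le
      have h1 := log_tangent_aux _ _ h0 hy
      have h2 := slope_aux β η (γ b) (p b) hβ hη0 (hγ b) (hp b) _ (hq b)
      have h3 : (min (p b * γ b) β - ptw b * γ b) / (1 + ptw b * γ b) ≤ (p b - ptw b) / η := by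
        rw [div_le_div_iff₀ (by linarith) hη0]; exact h2
      rw [Itw_eq_aux, Itw_eq_aux, min_eq_left hle]
      have e : (p b - ptw b) * (1 / (η * Real.log 2)) = (p b - ptw b) / η / Real.log 2 := by
        field_simp
      rw [e, ← add_div]
      exact div_le_div_of_nonneg_right (by linarith) hl2.le
    have h := Finset.sum_le_sum (s := Finset.univ) fun b _ => key b
    rw [Finset.sum_add_distrib, ← Finset.sum_mul, Finset.sum_sub_distrib] at h
    have h4 : (∑ b, p b - ∑ b, ptw b) * (1 / (η * Real.log 2)) ≤ 0 :=
      mul_nonpos_of_nonpos_of_nonneg (by linarith) (by positivity)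
    linarith
end

section
/- Let γ₁ ≥ γ₂ ≥ … ≥ γ_B > 0, β > 0, P > 0, and suppose Σ_{b=1}^B β/γ_b > B·P. Let k and l be integers with 0 ≤ l < k ≤ B, and let η = (B·P − Σ_{b=1}^l (β+1)/γ_b + Σ_{b=1}^k 1/γ_b)/(k − l). If η satisfies 1/γ_k < η and (η < 1/γ_{k+1} when k < B), and (β+1)/γ_l < η when l ≥ 1, and η ≤ (β+1)/γ_{l+1}, then Σ_{b=1}^B min{β/γ_b, (η − 1/γ_b)₊} = B·P, where x₊ = max{x,0}. In other words, the water level η determined by this explicit formula satisfies the truncated water-filling power budget with equality. -/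
open Finset

/-- with fading gains sorted decreasingly, `∑_{b=1}^B β/γ_b > B·P`, and the
water level `η = (B·P − ∑_{b=1}^l (β+1)/γ_b + ∑_{b=1}^k 1/γ_b)/(k−l)` for integers
`0 ≤ l < k ≤ B` satisfying `1/γ_k < η` (`< 1/γ_{k+1}` if `k < B`) and
`(β+1)/γ_l < η ≤ (β+1)/γ_{l+1}` (the left inequality when `l ≥ 1`), the truncated
water-filling allocation meets the power budget with equality:
`∑_{b=1}^B min{β/γ_b, (η − 1/γ_b)₊} = B·P`. -/
theorem truncated_waterfilling_water_level
    (B : ℕ) (hB : 1 ≤ B) (β P : ℝ) (hβ : 0 < β) (hP : 0 < P)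
    (γ : ℕ → ℝ) (hγpos : ∀ b, 1 ≤ b → b ≤ B → 0 < γ b)
    (hsort : ∀ i j, 1 ≤ i → i ≤ j → j ≤ B → γ j ≤ γ i)
    (hbudget : (B : ℝ) * P < ∑ b ∈ Finset.Icc 1 B, β / γ b)
    (k l : ℕ) (hlk : l < k) (hkB : k ≤ B)
    (η : ℝ)
    (hη : η = ((B : ℝ) * P - (∑ b ∈ Finset.Icc 1 l, (β + 1) / γ b)
      + ∑ b ∈ Finset.Icc 1 k, 1 / γ b) / ((k : ℝ) - (l : ℝ)))
    (hk1 : 1 / γ k < η) (hk2 : k < B → η < 1 / γ (k + 1))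
    (hl1 : 1 ≤ l → (β + 1) / γ l < η) (hl2 : η ≤ (β + 1) / γ (l + 1)) :
    ∑ b ∈ Finset.Icc 1 B, min (β / γ b) (max (η - 1 / γ b) 0) = (B : ℝ) * P := by
  have key : ∀ m, m ≤ B → ∀ f : ℕ → ℝ,
      ∑ b ∈ Finset.Icc 1 B, (if b ≤ m then f b else 0) = ∑ b ∈ Finset.Icc 1 m, f b := by
    intro m hm f
    rw [← Finset.sum_filter]
    apply Finset.sum_congr _ (fun _ _ => rfl)
    ext b
    simp only [Finset.mem_filter, Finset.mem_Icc]
    omega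
  have hinv : ∀ i j, 1 ≤ i → i ≤ j → j ≤ B → 1 / γ i ≤ 1 / γ j := by
    intro i j h1 h2 h3
    exact one_div_le_one_div_of_le (hγpos j (by omega) h3) (hsort i j h1 h2 h3)
  have hsplit : ∀ b, (β + 1) / γ b = (β + 1) * (1 / γ b) := fun b => by ring
  have hsplit2 : ∀ b, β / γ b = β * (1 / γ b) := fun b => by ring
  have hpt : ∀ b ∈ Finset.Icc 1 B, min (β / γ b) (max (η - 1 / γ b) 0)
      = (if b ≤ l then ((β + 1) / γ b - η) else 0) + (if b ≤ k then (η - 1 / γ b) else 0) := by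
    intro b hb
    rw [Finset.mem_Icc] at hb
    obtain ⟨hb1, hbB⟩ := hb
    have hpos : 0 < 1 / γ b := one_div_pos.mpr (hγpos b hb1 hbB)
    have hbpos : 0 < β * (1 / γ b) := mul_pos hβ hpos
    rw [hsplit, hsplit2]
    by_cases h1 : b ≤ l
    · have h2 := hl1 (by omega)
      have h3 := mul_le_mul_of_nonneg_left (hinv b l hb1 h1 (by omega)) (by linarith : 0 ≤ β + 1)
      rw [hsplit] at h2
      rw [if_pos h1, if_pos (by omega), min_eq_left]
      · ring
      · exact le_max_of_le_left (by linarith)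
    · by_cases h4 : b ≤ k
      · have h3 := mul_le_mul_of_nonneg_left (hinv (l + 1) b (by omega) (by omega) hbB)
          (by linarith : 0 ≤ β + 1)
        have h5 := hinv b k hb1 h4 hkB
        rw [hsplit] at hl2
        rw [if_neg h1, if_pos h4, max_eq_left (by linarith), min_eq_right (by linarith)]
        ring
      · have h5 := hinv (k + 1) b (by omega) (by omega) hbB
        have h6 := hk2 (by omega)
        rw [if_neg h1, if_neg h4, max_eq_right (by linarith), min_eq_right hbpos.le]
        ring
  rw [Finset.sum_congr rfl hpt, Finset.sum_add_distrib, key l (by omega), key k hkB,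
    Finset.sum_sub_distrib, Finset.sum_sub_distrib]
  have hkl : (0 : ℝ) < (k : ℝ) - (l : ℝ) := sub_pos.mpr (by exact_mod_cast hlk)
  rw [eq_div_iff hkl.ne'] at hη
  simp only [Finset.sum_const, Nat.card_Icc, Nat.add_sub_cancel, nsmul_eq_mul]
  linarith
end

section
/- Let the fading gains γ₁,…,γ_B be i.i.d. Nakagami-m power gains with parameter m > 0 and product law μ on ℝ₊^B. Fix β > 0 and a rate R with 0 < R < I_𝒳(β). For each P > 0, let p^{tw,P} : ℝ₊^B → ℝ₊^B be a measurable allocation rule such that for μ-almost every γ, p^{tw,P}(γ) maximizes Σ_{b=1}^B I^tw(p_b γ_b) over {p ∈ ℝ₊^B : Σ_{b=1}^B p_b ≤ B·P}, where I^tw(ρ) = min{log₂(1+ρ), log₂(1+β)}. Then limsup_{P→∞} log μ{γ : Σ_{b=1}^B I_𝒳(p^{tw,P}_b(γ) γ_b) < B·R} / log P ≤ −m·d_β(R), where d_β(R) = 1 + ⌊B(1 − R/I_𝒳(β))⌋. That is, the outage probability of the truncated water-filling scheme is asymptotically upper bounded by a constant times P^{−m·d_β(R)}. -/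
open MeasureTheory Finset

namespace TW
open Real

noncomputable def G : Measure ℂ :=
  volume.withDensity fun z => ENNReal.ofReal (Real.pi⁻¹ * Real.exp (-‖z‖ ^ 2))

noncomputable def k (u z : ℂ) : ℝ := -‖u + z‖ ^ 2 + ‖z‖ ^ 2

noncomputable def F (𝒳 : Finset ℂ) (x : ℂ) (r : ℝ) (z : ℂ) : ℝ :=
  ∑ x' ∈ 𝒳, Real.exp (k ((r : ℂ) * (x - x')) z)

lemma int_gauss (b : ℝ) (hb : 0 < b) : Integrable (fun z : ℂ => Real.exp (-b * ‖z‖ ^ 2)) := by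
  have := (GaussianFourier.integrable_cexp_neg_mul_sq_norm_add (V := ℂ) (b := (b:ℂ)) (by simpa using hb) 0 0).norm
  refine this.congr (Filter.Eventually.of_forall fun z => ?_)
  simp only [Complex.norm_exp]
  congr 1
  simp [← Complex.ofReal_pow]

lemma int_gauss_val : ∫ z : ℂ, Real.exp (-‖z‖ ^ 2) = Real.pi := by
  have := GaussianFourier.integral_rexp_neg_mul_sq_norm (V := ℂ) (b := 1) one_pos
  simpa using this

lemma int_gauss1 : Integrable (fun z : ℂ => Real.exp (-‖z‖ ^ 2)) := by
  simpa using int_gauss 1 one_pos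

lemma integrable_G {f : ℂ → ℝ} :
    Integrable f G ↔ Integrable (fun z : ℂ => (Real.pi⁻¹ * Real.exp (-‖z‖ ^ 2)) * f z) := by
  unfold G
  rw [integrable_withDensity_iff_integrable_smul']
  · refine integrable_congr (Filter.Eventually.of_forall fun z => ?_)
    simp only [smul_eq_mul]
    rw [ENNReal.toReal_ofReal (by positivity)]
  · fun_prop
  · exact Filter.Eventually.of_forall fun z => ENNReal.ofReal_lt_top

lemma integral_G (f : ℂ → ℝ) :
    ∫ z, f z ∂G = ∫ z : ℂ, (Real.pi⁻¹ * Real.exp (-‖z‖ ^ 2)) * f z := by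
  unfold G
  rw [integral_withDensity_eq_integral_toReal_smul]
  · refine integral_congr_ae (Filter.Eventually.of_forall fun z => ?_)
    simp only [smul_eq_mul]
    rw [ENNReal.toReal_ofReal (by positivity)]
  · fun_prop
  · exact Filter.Eventually.of_forall fun z => ENNReal.ofReal_lt_top

instance : IsProbabilityMeasure G := by
  constructor
  unfold G
  rw [withDensity_apply _ MeasurableSet.univ, Measure.restrict_univ,
    ← ofReal_integral_eq_lintegral_ofReal (int_gauss1.const_mul _)
      (Filter.Eventually.of_forall fun z => by positivity), integral_const_mul, int_gauss_val]
  simp [Real.pi_ne_zero]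

lemma dens_k (u z : ℂ) : (Real.pi⁻¹ * Real.exp (-‖z‖ ^ 2)) * Real.exp (k u z)
    = Real.pi⁻¹ * Real.exp (-‖z + u‖ ^ 2) := by
  rw [mul_assoc, ← Real.exp_add]
  congr 2
  unfold k
  rw [add_comm u z]; ring

lemma int_k (u : ℂ) : Integrable (fun z => Real.exp (k u z)) G := by
  rw [integrable_G]
  simp only [dens_k]
  exact (int_gauss1.comp_add_right u).const_mul _

lemma int_k_val (u : ℂ) : ∫ z, Real.exp (k u z) ∂G = 1 := by
  rw [integral_G]
  simp only [dens_k]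
  rw [integral_const_mul, integral_add_right_eq_self (fun z : ℂ => Real.exp (-‖z‖ ^ 2)), int_gauss_val]
  exact inv_mul_cancel₀ Real.pi_ne_zero

lemma k_mehler (a s : ℝ) (h : a ^ 2 + s ^ 2 = 1) (u z w : ℂ) :
    k u ((a:ℂ) * z + (s:ℂ) * w) = k ((a:ℂ) * u) z + k ((s:ℂ) * u) w := by
  unfold k
  simp only [Complex.sq_norm, Complex.normSq_apply, Complex.add_re, Complex.add_im, Complex.mul_re,
    Complex.mul_im, Complex.ofReal_re, Complex.ofReal_im]
  linear_combination (u.re ^2 + u.im^2) * h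

lemma norm_sq_rot (a s : ℝ) (h : a ^ 2 + s ^ 2 = 1) (z w : ℂ) :
    ‖(a:ℂ) * z + (s:ℂ) * w‖ ^ 2 + ‖(s:ℂ) * z - (a:ℂ) * w‖ ^ 2 = ‖z‖ ^ 2 + ‖w‖ ^ 2 := by
  simp only [Complex.sq_norm, Complex.normSq_apply, Complex.add_re, Complex.add_im, Complex.mul_re,
    Complex.sub_re, Complex.sub_im,
    Complex.mul_im, Complex.ofReal_re, Complex.ofReal_im]
  linear_combination (z.re ^2 + z.im^2 + w.re^2 + w.im^2) * h

noncomputable def T (a s : ℝ) : (ℂ × ℂ) →ₗ[ℝ] (ℂ × ℂ) where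
  toFun p := ((a:ℂ) * p.1 + (s:ℂ) * p.2, (s:ℂ) * p.1 - (a:ℂ) * p.2)
  map_add' p q := by ext1 <;> simp <;> ring
  map_smul' c p := by ext1 <;> simp <;> ring

lemma T_T (a s : ℝ) (h : a ^ 2 + s ^ 2 = 1) (p : ℂ × ℂ) : T a s (T a s p) = p := by
  have h' : (a:ℂ) ^ 2 + (s:ℂ) ^ 2 = 1 := by exact_mod_cast h
  ext1
  · simp [T]; linear_combination p.1 * h'
  · simp [T]; linear_combination p.2 * h'

lemma det_T (a s : ℝ) (h : a ^ 2 + s ^ 2 = 1) : |LinearMap.det (T a s)| = 1 := by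
  have h1 : T a s ∘ₗ T a s = LinearMap.id := by
    ext1 <;> ext1 <;> exact T_T a s h _
  have h2 := congrArg LinearMap.det h1
  rw [LinearMap.det_comp, LinearMap.det_id] at h2
  have h3 : |LinearMap.det (T a s)| * |LinearMap.det (T a s)| = 1 := by
    rw [← abs_mul, h2, abs_one]
  nlinarith [abs_nonneg (LinearMap.det (T a s))]

lemma T_cont (a s : ℝ) : Continuous (T a s) := LinearMap.continuous_of_finiteDimensional _

lemma T_vol (a s : ℝ) (h : a ^ 2 + s ^ 2 = 1) :
    Measure.map (T a s) (volume : Measure (ℂ × ℂ)) = volume := by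
  have hd := det_T a s h
  have h0 : LinearMap.det (T a s) ≠ 0 := by
    intro h0; rw [h0] at hd; simp at hd
  have : (volume : Measure (ℂ × ℂ)).IsAddHaarMeasure := by
    rw [Measure.volume_eq_prod]; infer_instance
  have := Measure.map_linearMap_addHaar_eq_smul_addHaar (volume : Measure (ℂ × ℂ)) h0
  rw [this, abs_inv, hd]; simp

lemma GG : G.prod G = (volume : Measure (ℂ × ℂ)).withDensity
    (fun p => ENNReal.ofReal (Real.pi⁻¹ ^ 2 * Real.exp (-(‖p.1‖ ^ 2 + ‖p.2‖ ^ 2)))) := by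
  unfold G
  rw [prod_withDensity (by fun_prop) (by fun_prop)]
  congr 1
  funext p
  rw [← ENNReal.ofReal_mul (by positivity)]
  congr 1
  rw [neg_add, Real.exp_add]; ring

lemma GG_rot (a s : ℝ) (h : a ^ 2 + s ^ 2 = 1) :
    Measure.map (T a s) (G.prod G) = G.prod G := by
  ext A hA
  have hm : Measurable (T a s) := (T_cont a s).measurable
  rw [Measure.map_apply hm hA, GG, withDensity_apply _ hA, withDensity_apply _ (hm hA)]
  conv_rhs => rw [← T_vol a s h]
  rw [setLIntegral_map hA (by fun_prop) hm]
  refine lintegral_congr fun p => ?_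
  congr 3
  rw [← norm_sq_rot a s h]; rfl

lemma G_mix (a s : ℝ) (h : a ^ 2 + s ^ 2 = 1) :
    MeasurePreserving (fun p : ℂ × ℂ => (a:ℂ) * p.1 + (s:ℂ) * p.2) (G.prod G) G := by
  have h1 : MeasurePreserving (T a s) (G.prod G) (G.prod G) :=
    ⟨(T_cont a s).measurable, GG_rot a s h⟩
  exact (measurePreserving_fst (μ := G) (ν := G)).comp h1

lemma F_int (𝒳 : Finset ℂ) (x : ℂ) (r : ℝ) : Integrable (F 𝒳 x r) G := by
  unfold F
  exact integrable_finsetSum _ fun _ _ => int_k _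

lemma F_cont (𝒳 : Finset ℂ) (x : ℂ) (r : ℝ) : Continuous (F 𝒳 x r) := by
  unfold F k
  fun_prop

lemma F_ge_one (𝒳 : Finset ℂ) (x : ℂ) (hx : x ∈ 𝒳) (r : ℝ) (z : ℂ) : 1 ≤ F 𝒳 x r z := by
  have := Finset.single_le_sum (f := fun x' => Real.exp (k ((r : ℂ) * (x - x')) z))
    (fun _ _ => (Real.exp_pos _).le) hx
  simpa [F, k] using this

lemma logF_cont (𝒳 : Finset ℂ) (x : ℂ) (hx : x ∈ 𝒳) (r : ℝ) :
    Continuous (fun z => Real.log (F 𝒳 x r z)) :=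
  (F_cont 𝒳 x r).log fun z => by have := F_ge_one 𝒳 x hx r z; linarith

lemma logF_int (𝒳 : Finset ℂ) (x : ℂ) (hx : x ∈ 𝒳) (r : ℝ) :
    Integrable (fun z => Real.log (F 𝒳 x r z)) G := by
  refine (F_int 𝒳 x r).mono' (logF_cont 𝒳 x hx r).aestronglyMeasurable
    (Filter.Eventually.of_forall fun z => ?_)
  have := F_ge_one 𝒳 x hx r z
  rw [Real.norm_eq_abs, abs_of_nonneg (Real.log_nonneg this)]
  have := Real.log_le_sub_one_of_pos (show 0 < F 𝒳 x r z by linarith)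
  linarith

lemma F_mehler (𝒳 : Finset ℂ) (x : ℂ) (r a s : ℝ) (h : a ^ 2 + s ^ 2 = 1) (z : ℂ) :
    Integrable (fun w => F 𝒳 x r ((a:ℂ) * z + (s:ℂ) * w)) G ∧
    ∫ w, F 𝒳 x r ((a:ℂ) * z + (s:ℂ) * w) ∂G = F 𝒳 x (a * r) z := by
  unfold F
  simp only [k_mehler a s h, Real.exp_add]
  constructor
  · exact integrable_finsetSum _ fun _ _ => (int_k _).const_mul _
  · rw [integral_finsetSum _ fun _ _ => (int_k _).const_mul _]
    refine Finset.sum_congr rfl fun x' _ => ?_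
    rw [integral_const_mul, int_k_val, mul_one]
    congr 2
    push_cast; ring

lemma logF_mono (𝒳 : Finset ℂ) (x : ℂ) (hx : x ∈ 𝒳) (r a s : ℝ) (h : a ^ 2 + s ^ 2 = 1) :
    ∫ z, Real.log (F 𝒳 x r z) ∂G ≤ ∫ z, Real.log (F 𝒳 x (a * r) z) ∂G := by
  have hp := G_mix a s h
  have hint : Integrable (fun p : ℂ × ℂ => Real.log (F 𝒳 x r ((a:ℂ) * p.1 + (s:ℂ) * p.2)))
      (G.prod G) := hp.integrable_comp_of_integrable (logF_int 𝒳 x hx r)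
  have e1 : ∫ z, Real.log (F 𝒳 x r z) ∂G =
      ∫ z, ∫ w, Real.log (F 𝒳 x r ((a:ℂ) * z + (s:ℂ) * w)) ∂G ∂G := by
    rw [← integral_prod _ hint, ← hp.map_eq]
    rw [integral_map hp.measurable.aemeasurable (logF_cont 𝒳 x hx r).aestronglyMeasurable]
    rw [hp.map_eq]
  rw [e1]
  refine integral_mono_ae hint.integral_prod_left (logF_int 𝒳 x hx _) ?_
  filter_upwards [hint.prod_right_ae] with z hz
  obtain ⟨h1, h2⟩ := F_mehler 𝒳 x r a s h z
  have hv : 0 < F 𝒳 x (a * r) z := by have := F_ge_one 𝒳 x hx (a * r) z; linarith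
  set v := F 𝒳 x (a * r) z
  calc ∫ w, Real.log (F 𝒳 x r ((a:ℂ) * z + (s:ℂ) * w)) ∂G
      ≤ ∫ w, (Real.log v - 1 + v⁻¹ * F 𝒳 x r ((a:ℂ) * z + (s:ℂ) * w)) ∂G := by
        refine integral_mono hz ((integrable_const _).add (h1.const_mul _)) fun w => ?_
        have hu : 0 < F 𝒳 x r ((a:ℂ) * z + (s:ℂ) * w) := by
          have := F_ge_one 𝒳 x hx r ((a:ℂ) * z + (s:ℂ) * w); linarith
        have := Real.log_le_sub_one_of_pos (div_pos hu hv)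
        rw [Real.log_div hu.ne' hv.ne', div_eq_inv_mul] at this
        simp only
        linarith
    _ = Real.log v := by
        rw [integral_add (integrable_const _) (h1.const_mul _), integral_const_mul, h2]
        simp only [integral_const, probReal_univ, one_smul]
        rw [inv_mul_cancel₀ hv.ne']; ring

lemma mi_eq (𝒳 : Finset ℂ) (ρ : ℝ) : mutualInfo 𝒳 ρ = Real.logb 2 𝒳.card -
    (𝒳.card : ℝ)⁻¹ * ∑ x ∈ 𝒳, (∫ z, Real.log (F 𝒳 x (Real.sqrt ρ) z) ∂G) / Real.log 2 := by
  unfold mutualInfo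
  congr 2
  refine Finset.sum_congr rfl fun x _ => ?_
  rw [← integral_div, integral_G]
  rfl

lemma mi_mono (𝒳 : Finset ℂ) (ρ₁ ρ₂ : ℝ) (h1 : 0 ≤ ρ₁) (h12 : ρ₁ ≤ ρ₂) :
    mutualInfo 𝒳 ρ₁ ≤ mutualInfo 𝒳 ρ₂ := by
  rcases h12.eq_or_lt with rfl | hlt
  · exact le_rfl
  have h2 : 0 < ρ₂ := by linarith
  have hq : 0 ≤ ρ₁ / ρ₂ := by positivity
  have hq1 : ρ₁ / ρ₂ ≤ 1 := by rw [div_le_one h2]; exact h12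
  have hl := Real.log_pos (show (1:ℝ) < 2 by norm_num)
  rw [mi_eq, mi_eq]
  refine sub_le_sub_left (mul_le_mul_of_nonneg_left (Finset.sum_le_sum fun x hx =>
    div_le_div_of_nonneg_right ?_ hl.le) (by positivity)) _
  have := logF_mono 𝒳 x hx (Real.sqrt ρ₂) (Real.sqrt (ρ₁ / ρ₂)) (Real.sqrt (1 - ρ₁ / ρ₂))
    (by rw [Real.sq_sqrt hq, Real.sq_sqrt (by linarith)]; ring)
  rwa [← Real.sqrt_mul hq, div_mul_cancel₀ _ h2.ne'] at this

lemma mi_zero (𝒳 : Finset ℂ) (hc : 0 < 𝒳.card) : mutualInfo 𝒳 0 = 0 := by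
  rw [mi_eq]
  have : (𝒳.card : ℝ) ≠ 0 := by positivity
  simp only [F, k, Real.sqrt_zero]
  simp [Real.logb]
  field_simp
  simp

lemma mi_nonneg (𝒳 : Finset ℂ) (hc : 0 < 𝒳.card) (ρ : ℝ) (h : 0 ≤ ρ) : 0 ≤ mutualInfo 𝒳 ρ := by
  rw [← mi_zero 𝒳 hc]; exact mi_mono _ _ _ le_rfl h

lemma norm_int : Integrable (fun z : ℂ => ‖z‖) G := by
  rw [integrable_G]
  refine ((int_gauss (1/2) (by norm_num)).const_mul Real.pi⁻¹).mono' (by fun_prop)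
    (Filter.Eventually.of_forall fun z => ?_)
  rw [Real.norm_eq_abs, abs_of_nonneg (by positivity), mul_assoc]
  gcongr
  have h1 : ‖z‖ ≤ Real.exp (1/2 * ‖z‖^2) := by
    have := Real.add_one_le_exp (1/2 * ‖z‖^2)
    nlinarith [sq_nonneg (‖z‖ - 1)]
  calc Real.exp (-‖z‖^2) * ‖z‖ ≤ Real.exp (-‖z‖^2) * Real.exp (1/2 * ‖z‖^2) := by gcongr
    _ = _ := by rw [← Real.exp_add]; ring_nf

lemma k_lower (u z : ℂ) : -(‖u‖ ^ 2 + 2 * ‖u‖ * ‖z‖) ≤ k u z := by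
  unfold k
  have := norm_add_le u z
  nlinarith [norm_nonneg (u+z), norm_nonneg u, norm_nonneg z]

lemma mi_small (𝒳 : Finset ℂ) (hc : 0 < 𝒳.card) :
    ∃ C : ℝ, 0 ≤ C ∧ ∀ ρ, 0 ≤ ρ → ρ ≤ 1 → mutualInfo 𝒳 ρ ≤ C * Real.sqrt ρ := by
  have hl := Real.log_pos (show (1:ℝ) < 2 by norm_num)
  set D : ℝ := ∑ x ∈ 𝒳, ∑ x' ∈ 𝒳, ‖x - x'‖ with hD
  have hDle : ∀ x ∈ 𝒳, ∀ x' ∈ 𝒳, ‖x - x'‖ ≤ D := by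
    intro x hx x' hx'
    refine (Finset.single_le_sum (f := fun x' => ‖x - x'‖) (fun _ _ => norm_nonneg _) hx').trans ?_
    exact Finset.single_le_sum (f := fun x => ∑ x' ∈ 𝒳, ‖x - x'‖)
      (fun _ _ => Finset.sum_nonneg fun _ _ => norm_nonneg _) hx
  have hD0 : 0 ≤ D := Finset.sum_nonneg fun _ _ => Finset.sum_nonneg fun _ _ => norm_nonneg _
  set N : ℝ := ∫ z, ‖z‖ ∂G
  have hN : 0 ≤ N := integral_nonneg fun _ => norm_nonneg _
  have hcr : (0:ℝ) < 𝒳.card := by exact_mod_cast hc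
  refine ⟨(D ^ 2 + 2 * D * N) / Real.log 2, by positivity, fun ρ h0 h1 => ?_⟩
  set r := Real.sqrt ρ
  have hr0 : 0 ≤ r := Real.sqrt_nonneg _
  have hr1 : r ≤ 1 := Real.sqrt_le_one.mpr h1
  have key : ∀ x ∈ 𝒳, Real.log 𝒳.card - (D ^ 2 + 2 * D * N) * r ≤
      ∫ z, Real.log (F 𝒳 x r z) ∂G := by
    intro x hx
    have i1 : Integrable (fun z : ℂ => 2 * D * r * ‖z‖) G := norm_int.const_mul _
    calc Real.log 𝒳.card - (D ^ 2 + 2 * D * N) * r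
        = ∫ z : ℂ, ((Real.log 𝒳.card - D ^ 2 * r) - 2 * D * r * ‖z‖) ∂G := by
          rw [integral_sub (integrable_const _) i1, integral_const_mul]
          simp only [integral_const, probReal_univ, one_smul]
          ring
      _ ≤ _ := by
          refine integral_mono ((integrable_const _).sub i1) (logF_int 𝒳 x hx r) fun z => ?_
          have hF : 𝒳.card * Real.exp (-(D^2 * r + 2 * D * r * ‖z‖)) ≤ F 𝒳 x r z := by
            unfold F
            rw [← nsmul_eq_mul]
            refine Finset.card_nsmul_le_sum _ _ _ fun x' hx' => ?_
            rw [Real.exp_le_exp]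
            refine le_trans ?_ (k_lower _ _)
            have e : ‖(r:ℂ) * (x - x')‖ = r * ‖x - x'‖ := by simp [abs_of_nonneg hr0]
            rw [e]
            have hd := hDle x hx x' hx'
            have hd0 := norm_nonneg (x - x')
            have a1 : (r * ‖x - x'‖) ≤ D * r := by nlinarith
            have a2 : (r * ‖x - x'‖) ^ 2 ≤ D^2 * r := by
              calc (r * ‖x - x'‖) ^ 2 ≤ (D * r) ^ 2 := by gcongr
                _ = D^2 * (r * r) := by ring
                _ ≤ D^2 * (r * 1) := by gcongr
                _ = _ := by ring
            have a3 := mul_le_mul_of_nonneg_right a1 (norm_nonneg z)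
            linarith
          have := Real.log_le_log (by positivity) hF
          rw [Real.log_mul hcr.ne' (Real.exp_pos _).ne', Real.log_exp] at this
          simp only
          linarith
  rw [mi_eq]
  have hs : (𝒳.card : ℝ) * ((Real.log 𝒳.card - (D ^ 2 + 2 * D * N) * r) / Real.log 2) ≤
      ∑ x ∈ 𝒳, (∫ z, Real.log (F 𝒳 x r z) ∂G) / Real.log 2 := by
    rw [← nsmul_eq_mul]
    refine Finset.card_nsmul_le_sum _ _ _ fun x hx => ?_
    have := key x hx
    gcongr
  have hs2 := mul_le_mul_of_nonneg_left hs (inv_nonneg.mpr hcr.le)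
  rw [← mul_assoc, inv_mul_cancel₀ hcr.ne', one_mul] at hs2
  unfold Real.logb
  have e : (Real.log 𝒳.card - (D ^ 2 + 2 * D * N) * r) / Real.log 2 =
    Real.log 𝒳.card / Real.log 2 - (D ^ 2 + 2 * D * N) / Real.log 2 * r := by ring
  linarith

lemma nak_gamma (m : ℝ) : nakagamiMeasure m = ProbabilityTheory.gammaMeasure m m := by
  unfold nakagamiMeasure ProbabilityTheory.gammaMeasure
  congr 1
  funext γ
  unfold ProbabilityTheory.gammaPDF ProbabilityTheory.gammaPDFReal
  congr 2
  rw [neg_mul]; ring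

lemma nak_prob (m : ℝ) (hm : 0 < m) : IsProbabilityMeasure (nakagamiMeasure m) := by
  rw [nak_gamma]; exact ProbabilityTheory.isProbabilityMeasure_gammaMeasure hm hm

lemma nak_neg (m : ℝ) : nakagamiMeasure m (Set.Iio 0) = 0 := by
  unfold nakagamiMeasure
  rw [withDensity_apply _ measurableSet_Iio, setLIntegral_congr_fun (g := fun _ => 0) measurableSet_Iio]
  · simp
  · intro x hx
    simp [not_le.mpr (Set.mem_Iio.mp hx)]

lemma lint_rpow (m : ℝ) (hm : 0 < m) (A t : ℝ) (hA : 0 ≤ A) (ht : 0 < t) :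
    ∫⁻ x in Set.Ioc 0 t, ENNReal.ofReal (A * x ^ (m - 1)) = ENNReal.ofReal (A * t ^ m / m) := by
  rw [← ofReal_integral_eq_lintegral_ofReal]
  · rw [← intervalIntegral.integral_of_le ht.le, intervalIntegral.integral_const_mul,
      integral_rpow (Or.inl (by linarith))]
    simp [Real.zero_rpow hm.ne', mul_div_assoc]
  · have := (intervalIntegral.intervalIntegrable_rpow' (a := 0) (b := t) (r := m - 1)
      (by linarith)).const_mul A
    rwa [intervalIntegrable_iff_integrableOn_Ioc_of_le ht.le] at this
  · filter_upwards [ae_restrict_mem measurableSet_Ioc] with x hx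
    have := hx.1
    simp only [Pi.zero_apply]
    positivity

lemma nak_Icc (m t : ℝ) : nakagamiMeasure m (Set.Icc 0 t) =
    ∫⁻ x in Set.Ioc 0 t, ENNReal.ofReal (m ^ m * x ^ (m - 1) * Real.exp (-m * x) / Real.Gamma m) := by
  unfold nakagamiMeasure
  rw [withDensity_apply _ measurableSet_Icc, setLIntegral_congr Ioc_ae_eq_Icc.symm]
  refine setLIntegral_congr_fun measurableSet_Ioc fun x hx => ?_
  simp [hx.1.le]

lemma nak_upper (m : ℝ) (hm : 0 < m) : ∃ c : ℝ, 0 < c ∧ ∀ t, 0 < t →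
    nakagamiMeasure m (Set.Iic t) ≤ ENNReal.ofReal (c * t ^ m) := by
  have hG := Real.Gamma_pos_of_pos hm
  have hmm : 0 < m ^ m := Real.rpow_pos_of_pos hm m
  refine ⟨m ^ m / Real.Gamma m / m, by positivity, fun t ht => ?_⟩
  have h1 : nakagamiMeasure m (Set.Iic t) ≤ nakagamiMeasure m (Set.Icc 0 t) := by
    have : Set.Iic t ⊆ Set.Iio 0 ∪ Set.Icc 0 t := by
      intro x hx
      rcases lt_or_ge x 0 with h | h
      · exact Or.inl h
      · exact Or.inr ⟨h, hx⟩
    refine (measure_mono this).trans ((measure_union_le _ _).trans ?_)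
    rw [nak_neg, zero_add]
  refine h1.trans ?_
  rw [nak_Icc, show m ^ m / Real.Gamma m / m * t ^ m = (m ^ m / Real.Gamma m) * t ^ m / m by ring,
    ← lint_rpow m hm _ t (by positivity) ht]
  refine setLIntegral_mono' measurableSet_Ioc fun x hx => ENNReal.ofReal_le_ofReal ?_
  have hx0 := hx.1
  have : Real.exp (-m * x) ≤ 1 := Real.exp_le_one_iff.mpr (by nlinarith)
  calc m ^ m * x ^ (m - 1) * Real.exp (-m * x) / Real.Gamma m
      ≤ m ^ m * x ^ (m - 1) * 1 / Real.Gamma m := by gcongr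
    _ = _ := by ring

lemma nak_lower (m : ℝ) (hm : 0 < m) : ∃ c : ℝ, 0 < c ∧ ∀ t, 0 < t → t ≤ 1 →
    ENNReal.ofReal (c * t ^ m) ≤ nakagamiMeasure m (Set.Icc 0 t) := by
  have hG := Real.Gamma_pos_of_pos hm
  have hmm : 0 < m ^ m := Real.rpow_pos_of_pos hm m
  refine ⟨m ^ m * Real.exp (-m) / Real.Gamma m / m, by positivity, fun t ht ht1 => ?_⟩
  rw [nak_Icc, show m ^ m * Real.exp (-m) / Real.Gamma m / m * t ^ m =
      (m ^ m * Real.exp (-m) / Real.Gamma m) * t ^ m / m by ring,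
    ← lint_rpow m hm _ t (by positivity) ht]
  refine setLIntegral_mono' measurableSet_Ioc fun x hx => ENNReal.ofReal_le_ofReal ?_
  have hx0 := hx.1
  have hx1 := hx.2
  have : Real.exp (-m) ≤ Real.exp (-m * x) := Real.exp_le_exp.mpr (by nlinarith)
  calc m ^ m * Real.exp (-m) / Real.Gamma m * x ^ (m - 1)
      = m ^ m * x ^ (m - 1) * Real.exp (-m) / Real.Gamma m := by ring
    _ ≤ _ := by gcongr

lemma Itw_eq (β ρ : ℝ) (hβ : 0 < β) (hρ : 0 ≤ ρ) :
    Itw β ρ = min (Real.logb 2 (1 + ρ)) (Real.logb 2 (1 + β)) := by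
  unfold Itw
  split_ifs with h
  · rw [min_eq_left]
    exact Real.logb_le_logb_of_le (by norm_num) (by linarith) (by linarith)
  · rw [min_eq_right]
    exact Real.logb_le_logb_of_le (by norm_num) (by linarith) (by linarith)

lemma alloc (B : ℕ) (β P : ℝ) (hβ : 0 < β) (hP : 0 < P) (γ p : Fin B → ℝ)
    (hγ : ∀ b, 0 ≤ γ b) (hp : ∀ b, 0 ≤ p b) (hsum : ∑ b, p b ≤ (B : ℝ) * P)
    (hopt : ∀ q : Fin B → ℝ, (∀ b, 0 ≤ q b) → ∑ b, q b ≤ (B : ℝ) * P →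
          ∑ b, Itw β (q b * γ b) ≤ ∑ b, Itw β (p b * γ b))
    (b : Fin B) (hb : p b * γ b < β) : γ b ≤ (1 + β) / P := by
  by_contra! hc
  have hg : 0 < γ b := lt_trans (by positivity) hc
  rw [div_lt_iff₀ hP] at hc
  have hpb : p b < P := by
    by_contra! h
    nlinarith
  have hroom : 0 < β / γ b - p b := by
    rw [sub_pos, lt_div_iff₀ hg]; exact hb
  have key : ∀ δ, 0 < δ → δ ≤ β / γ b - p b →
      Itw β ((p b + δ) * γ b) - Itw β (p b * γ b) =
        Real.logb 2 (1 + (p b + δ) * γ b) - Real.logb 2 (1 + p b * γ b) := by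
    intro δ hδ hδ2
    have : (p b + δ) * γ b ≤ β := by
      rw [← le_div_iff₀ hg]; linarith
    unfold Itw
    rw [if_pos this, if_pos hb.le]
  by_cases hex : ∃ b', b' ≠ b ∧ P ≤ p b'
  · obtain ⟨b', hne, hPb⟩ := hex
    set κ := (1 + β) / γ b with hκ
    have hκP : κ < P := by rw [hκ, div_lt_iff₀ hg]; linarith
    have hκ0 : 0 < κ := by positivity
    obtain ⟨δ, hδ0, hδ1, hδ2⟩ : ∃ δ, 0 < δ ∧ δ ≤ β / γ b - p b ∧ δ < P - κ := by
      refine ⟨min (β / γ b - p b) ((P - κ) / 2), lt_min hroom (by linarith), min_le_left _ _, ?_⟩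
      exact (min_le_right _ _).trans_lt (by linarith)
    set q : Fin B → ℝ := fun c => p c + (if c = b then δ else 0) - (if c = b' then δ else 0) with hq
    have hqb : q b = p b + δ := by simp [hq, hne.symm]
    have hqb' : q b' = p b' - δ := by simp [hq, hne]
    have hq0 : ∀ c, 0 ≤ q c := by
      intro c
      by_cases h1 : c = b'
      · rw [h1, hqb']; linarith
      · simp only [hq, if_neg h1, sub_zero]
        have := hp c
        split_ifs <;> linarith
    have hqs : ∑ c, q c ≤ (B:ℝ) * P := by
      simp only [hq, Finset.sum_sub_distrib, Finset.sum_add_distrib, Finset.sum_ite_eq',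
        Finset.mem_univ, if_true]
      linarith
    have h := hopt q hq0 hqs
    have hdiff : ∑ c, (Itw β (q c * γ c) - Itw β (p c * γ c)) =
        (Itw β (q b * γ b) - Itw β (p b * γ b)) + (Itw β (q b' * γ b') - Itw β (p b' * γ b')) := by
      refine Finset.sum_eq_add b b' hne.symm ?_ (by simp) (by simp)
      intro c _ hc
      simp [hq, hc.1, hc.2]
    rw [Finset.sum_sub_distrib, hqb, hqb', key δ hδ0 hδ1] at hdiff
    have hg' := hγ b'
    have hA : 0 ≤ (p b' - δ) * γ b' := mul_nonneg (by linarith) hg'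
    have hA2 : (p b' - δ) * γ b' ≤ p b' * γ b' := by nlinarith
    have hloss : Itw β (p b' * γ b') - Itw β ((p b' - δ) * γ b') ≤
        Real.logb 2 (1 + p b' * γ b') - Real.logb 2 (1 + (p b' - δ) * γ b') := by
      rw [Itw_eq β _ hβ hA, Itw_eq β _ hβ (hA.trans hA2)]
      have hl : Real.logb 2 (1 + (p b' - δ) * γ b') ≤ Real.logb 2 (1 + p b' * γ b') :=
        Real.logb_le_logb_of_le (by norm_num) (by linarith) (by linarith)
      rcases min_cases (Real.logb 2 (1 + p b' * γ b')) (Real.logb 2 (1 + β)) with h1 | h1 <;>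
      rcases min_cases (Real.logb 2 (1 + (p b' - δ) * γ b')) (Real.logb 2 (1 + β)) with h2 | h2 <;>
      linarith [h1.1, h1.2, h2.1, h2.2]
    have hpbn := hp b
    have hpos1 : 0 < 1 + p b * γ b := by positivity
    have hpos2 : 0 < 1 + (p b + δ) * γ b := by positivity
    have hstrict : Real.logb 2 ((1 + p b' * γ b') * (1 + p b * γ b)) <
        Real.logb 2 ((1 + (p b + δ) * γ b) * (1 + (p b' - δ) * γ b')) := by
      refine Real.logb_lt_logb (by norm_num) (mul_pos (by linarith) hpos1) ?_
      have hκg : κ * γ b = 1 + β := by rw [hκ]; field_simp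
      have e : (1 + (p b + δ) * γ b) * (1 + (p b' - δ) * γ b') -
          (1 + p b' * γ b') * (1 + p b * γ b) =
          δ * (γ b + γ b' * ((p b' - δ) * γ b - (1 + p b * γ b))) := by ring
      have h3 : 0 ≤ (p b' - δ) * γ b - (1 + p b * γ b) := by
        have : κ * γ b ≤ (p b' - δ) * γ b := by
          apply mul_le_mul_of_nonneg_right _ hg.le; linarith
        linarith
      have : 0 < δ * (γ b + γ b' * ((p b' - δ) * γ b - (1 + p b * γ b))) := by positivity
      linarith
    rw [Real.logb_mul (by linarith) hpos1.ne', Real.logb_mul hpos2.ne' (by linarith)] at hstrict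
    linarith
  · push Not at hex
    have hlt : ∑ c, p c < (B:ℝ) * P := by
      have : ∑ c : Fin B, p c < ∑ c : Fin B, P := by
        refine Finset.sum_lt_sum_of_nonempty ⟨b, Finset.mem_univ b⟩ fun c _ => ?_
        by_cases h : c = b
        · rw [h]; exact hpb
        · exact hex c h
      simpa using this
    obtain ⟨δ, hδ0, hδ1, hδ2⟩ : ∃ δ, 0 < δ ∧ δ ≤ β / γ b - p b ∧ δ ≤ (B:ℝ) * P - ∑ c, p c :=
      ⟨min (β / γ b - p b) ((B:ℝ) * P - ∑ c, p c), lt_min hroom (by linarith), min_le_left _ _,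
        min_le_right _ _⟩
    set q : Fin B → ℝ := fun c => p c + (if c = b then δ else 0) with hq
    have hqb : q b = p b + δ := by simp [hq]
    have hq0 : ∀ c, 0 ≤ q c := by
      intro c
      simp only [hq]
      have := hp c
      split_ifs <;> linarith
    have hqs : ∑ c, q c ≤ (B:ℝ) * P := by
      simp only [hq, Finset.sum_add_distrib, Finset.sum_ite_eq', Finset.mem_univ, if_true]
      linarith
    have h := hopt q hq0 hqs
    have hdiff : ∑ c, (Itw β (q c * γ c) - Itw β (p c * γ c)) =
        (Itw β (q b * γ b) - Itw β (p b * γ b)) := by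
      refine Finset.sum_eq_single b ?_ (by simp)
      intro c _ hc
      simp [hq, hc]
    rw [Finset.sum_sub_distrib, hqb, key δ hδ0 hδ1] at hdiff
    have hpbn := hp b
    have : Real.logb 2 (1 + p b * γ b) < Real.logb 2 (1 + (p b + δ) * γ b) := by
      refine Real.logb_lt_logb (by norm_num) (by positivity) ?_
      nlinarith
    linarith

lemma count (B : ℕ) (f : Fin B → ℝ) (g : Fin B → ℝ) (β I R : ℝ) (hI : 0 < I) (h0 : 0 ≤ (B : ℝ) * (1 - R / I))
    (hf : ∀ b, 0 ≤ f b) (hfI : ∀ b, β ≤ g b → I ≤ f b) (hs : ∑ b, f b < (B:ℝ) * R) :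
    ⌊(B : ℝ) * (1 - R / I)⌋₊ + 1 ≤ (Finset.univ.filter fun b => g b < β).card := by
  have h1 : ((Finset.univ.filter fun b => ¬ g b < β).card : ℝ) * I ≤ ∑ b, f b := by
    rw [← nsmul_eq_mul]
    refine (Finset.card_nsmul_le_sum _ f I fun b hb => hfI b ?_).trans
      (Finset.sum_le_sum_of_subset_of_nonneg (Finset.filter_subset _ _) fun b _ _ => hf b)
    simpa using hb
  have h2 := Finset.card_filter_add_card_filter_not (s := (Finset.univ : Finset (Fin B)))
    (fun b => g b < β)
  simp only [Finset.card_univ, Fintype.card_fin] at h2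
  have h3 : ((Finset.univ.filter fun b => g b < β).card : ℝ) +
      ((Finset.univ.filter fun b => ¬ g b < β).card : ℝ) = B := by exact_mod_cast h2
  rw [Nat.add_one_le_iff, Nat.floor_lt h0]
  have : (B : ℝ) * (1 - R / I) = B - B * R / I := by ring
  rw [this]
  have : (Finset.univ.filter fun b => ¬ g b < β).card < B * R / I := by
    rw [lt_div_iff₀ hI]; linarith
  linarith

lemma pi_upper (B d : ℕ) (m : ℝ) (hm : 0 < m) (t : ℝ) (A : Set (Fin B → ℝ))
    (hA : ∀ᵐ γ ∂(Measure.pi fun _ : Fin B => nakagamiMeasure m),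
      γ ∈ A → d ≤ (Finset.univ.filter fun b => γ b ≤ t).card) :
    (Measure.pi fun _ : Fin B => nakagamiMeasure m) A ≤
      (B.choose d : ENNReal) * (nakagamiMeasure m (Set.Iic t)) ^ d := by
  have := nak_prob m hm
  set μ := (Measure.pi fun _ : Fin B => nakagamiMeasure m) with hμ
  calc μ A ≤ μ (⋃ S ∈ Finset.powersetCard d (Finset.univ : Finset (Fin B)),
        Set.pi Set.univ fun b => if b ∈ S then Set.Iic t else Set.univ) := by
        refine measure_mono_ae ?_
        filter_upwards [hA] with γ hγ hγA
        obtain ⟨S, hS, hSc⟩ := Finset.exists_subset_card_eq (hγ hγA)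
        refine Set.mem_iUnion₂.mpr ⟨S, by simp [Finset.mem_powersetCard, hSc], ?_⟩
        intro b _
        by_cases hb : b ∈ S
        · have := hS hb
          simp only [hb, if_true]
          simpa using this
        · simp [hb]
    _ ≤ ∑ S ∈ Finset.powersetCard d (Finset.univ : Finset (Fin B)),
        μ (Set.pi Set.univ fun b => if b ∈ S then Set.Iic t else Set.univ) :=
        measure_biUnion_finset_le _ _
    _ = ∑ S ∈ Finset.powersetCard d (Finset.univ : Finset (Fin B)),
        (nakagamiMeasure m (Set.Iic t)) ^ d := by
        refine Finset.sum_congr rfl fun S hS => ?_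
        rw [hμ, Measure.pi_pi]
        rw [← (Finset.mem_powersetCard.mp hS).2]
        have : ∀ b : Fin B, nakagamiMeasure m (if b ∈ S then Set.Iic t else Set.univ) =
            if b ∈ S then nakagamiMeasure m (Set.Iic t) else 1 := by
          intro b; split_ifs <;> simp
        simp only [this]
        rw [Finset.prod_ite_mem, Finset.univ_inter, Finset.prod_const]
    _ = _ := by
        rw [Finset.sum_const, Finset.card_powersetCard, Finset.card_univ, Fintype.card_fin,
          nsmul_eq_mul]

lemma pi_lower (B : ℕ) (m : ℝ) (hm : 0 < m) (t : ℝ) (A : Set (Fin B → ℝ))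
    (hA : ∀ᵐ γ ∂(Measure.pi fun _ : Fin B => nakagamiMeasure m),
      (∀ b, γ b ∈ Set.Icc 0 t) → γ ∈ A) :
    (nakagamiMeasure m (Set.Icc 0 t)) ^ B ≤
    (Measure.pi fun _ : Fin B => nakagamiMeasure m) A := by
  have := nak_prob m hm
  calc (nakagamiMeasure m (Set.Icc 0 t)) ^ B =
      (Measure.pi fun _ : Fin B => nakagamiMeasure m) (Set.pi Set.univ fun _ => Set.Icc 0 t) := by
        rw [Measure.pi_pi]; simp
    _ ≤ _ := by
        refine measure_mono_ae ?_
        filter_upwards [hA] with γ hγ h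
        exact hγ fun b => h b (Set.mem_univ b)

lemma ae_nonneg (B : ℕ) (m : ℝ) (hm : 0 < m) :
    ∀ᵐ γ ∂(Measure.pi fun _ : Fin B => nakagamiMeasure m), ∀ b, 0 ≤ γ b := by
  have := nak_prob m hm
  rw [ae_all_iff]
  intro b
  have h : ∀ᵐ x ∂(nakagamiMeasure m), 0 ≤ x := by
    rw [ae_iff]
    have : {x : ℝ | ¬ 0 ≤ x} = Set.Iio 0 := by ext; simp
    rw [this, nak_neg]
  exact (measurePreserving_eval (fun _ : Fin B => nakagamiMeasure m) b).quasiMeasurePreserving.ae h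

lemma limsup_aux (q : ℝ → ℝ) (K K' e e' : ℝ) (hK : 0 < K) (hK' : 0 < K')
    (hu : ∀ᶠ P in Filter.atTop, q P ≤ K * P ^ (-e))
    (hl : ∀ᶠ P in Filter.atTop, K' * P ^ (-e') ≤ q P) :
    Filter.limsup (fun P => Real.log (q P) / Real.log P) Filter.atTop ≤ -e := by
  have t1 : ∀ K c : ℝ, Filter.Tendsto (fun P => Real.log K / Real.log P + c) Filter.atTop
      (nhds c) := by
    intro K c
    have := (Real.tendsto_log_atTop.const_div_atTop (Real.log K)).add_const c
    simpa using this
  have hub : ∀ᶠ P in Filter.atTop, Real.log (q P) / Real.log P ≤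
      Real.log K / Real.log P + -e := by
    filter_upwards [hu, hl, Filter.eventually_gt_atTop 1] with P h1 h2 hP
    have hP0 : 0 < P := by linarith
    have hlP := Real.log_pos hP
    have hq : 0 < q P := lt_of_lt_of_le (by positivity) h2
    have := Real.log_le_log hq h1
    rw [Real.log_mul hK.ne' (by positivity), Real.log_rpow hP0] at this
    rw [div_le_iff₀ hlP, add_mul, div_mul_cancel₀ _ hlP.ne']
    exact this
  have hlb : ∀ᶠ P in Filter.atTop, Real.log K' / Real.log P + -e' ≤
      Real.log (q P) / Real.log P := by
    filter_upwards [hl, Filter.eventually_gt_atTop 1] with P h2 hP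
    have hP0 : 0 < P := by linarith
    have hlP := Real.log_pos hP
    have := Real.log_le_log (by positivity) h2
    rw [Real.log_mul hK'.ne' (by positivity), Real.log_rpow hP0] at this
    rw [le_div_iff₀ hlP, add_mul, div_mul_cancel₀ _ hlP.ne']
    exact this
  have hbdd : Filter.IsBoundedUnder (· ≥ ·) Filter.atTop
      (fun P => Real.log (q P) / Real.log P) :=
    (t1 K' (-e')).isBoundedUnder_ge.mono_ge hlb
  rw [← (t1 K (-e)).limsup_eq]
  exact Filter.limsup_le_limsup hub hbdd.isCoboundedUnder_le (t1 K (-e)).isBoundedUnder_le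

end TW

/-- with i.i.d. Nakagami-m fading and `0 < R < I_𝒳(β)`, the outage probability
of the truncated water-filling scheme (for each budget `P`, an a.e. maximizer of
`∑ I^tw(p_b γ_b)` under `∑ p_b ≤ B·P`) has SNR exponent asymptotically at least
`m·d_β(R)` with `d_β(R) = 1 + ⌊B(1 − R/I_𝒳(β))⌋`. -/
theorem truncated_waterfilling_outage_exponent_bound
    (B M : ℕ) (hB : 1 ≤ B) (𝒳 : Finset ℂ) (h𝒳 : 𝒳.card = 2 ^ M)
    (m : ℝ) (hm : 0 < m) (β : ℝ) (hβ : 0 < β)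
    (R : ℝ) (hR : 0 < R) (hRβ : R < mutualInfo 𝒳 β)
    (ptw : ℝ → (Fin B → ℝ) → (Fin B → ℝ))
    (hmeas : ∀ P : ℝ, 0 < P → Measurable (ptw P))
    (hopt : ∀ P : ℝ, 0 < P →
      ∀ᵐ γ ∂(Measure.pi fun _ : Fin B => nakagamiMeasure m),
        ((∀ b, 0 ≤ ptw P γ b) ∧ ∑ b, ptw P γ b ≤ (B : ℝ) * P) ∧
        ∀ p : Fin B → ℝ, (∀ b, 0 ≤ p b) → ∑ b, p b ≤ (B : ℝ) * P →
          ∑ b, Itw β (p b * γ b) ≤ ∑ b, Itw β (ptw P γ b * γ b)) :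
    Filter.limsup
      (fun P : ℝ =>
        Real.log ((Measure.pi fun _ : Fin B => nakagamiMeasure m)
          {γ | ∑ b, mutualInfo 𝒳 (ptw P γ b * γ b) < (B : ℝ) * R}).toReal
          / Real.log P)
      Filter.atTop
      ≤ -(m * (1 + (⌊(B : ℝ) * (1 - R / mutualInfo 𝒳 β)⌋ : ℝ))) := by
  have hc : 0 < 𝒳.card := by rw [h𝒳]; positivity
  have hI : 0 < mutualInfo 𝒳 β := hR.trans hRβ
  have hB0 : (0:ℝ) < B := by exact_mod_cast hB
  have hprob := TW.nak_prob m hm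
  have hfl : 0 ≤ (B : ℝ) * (1 - R / mutualInfo 𝒳 β) := by
    refine mul_nonneg hB0.le ?_
    rw [sub_nonneg, div_le_one hI]; exact hRβ.le
  set d : ℕ := ⌊(B : ℝ) * (1 - R / mutualInfo 𝒳 β)⌋₊ + 1 with hd
  have hde : m * (1 + (⌊(B : ℝ) * (1 - R / mutualInfo 𝒳 β)⌋ : ℝ)) = m * d := by
    rw [hd, ← natCast_floor_eq_intCast_floor hfl]; push_cast; ring
  rw [hde]
  obtain ⟨c₁, hc₁, hup⟩ := TW.nak_upper m hm
  obtain ⟨c₂, hc₂, hlo⟩ := TW.nak_lower m hm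
  obtain ⟨C, hC, hsmall⟩ := TW.mi_small 𝒳 hc
  obtain ⟨ε, hε0, hε1, hεR⟩ : ∃ ε : ℝ, 0 < ε ∧ ε ≤ 1 ∧ ∀ ρ, 0 ≤ ρ → ρ ≤ ε → mutualInfo 𝒳 ρ < R := by
    have hx : 0 < R / (C + 1) := by positivity
    refine ⟨min 1 ((R / (C + 1)) ^ 2), by positivity, min_le_left _ _, fun ρ h0 h1 => ?_⟩
    have h2 : Real.sqrt ρ ≤ R / (C + 1) := by
      rw [Real.sqrt_le_left hx.le]; exact h1.trans (min_le_right _ _)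
    calc mutualInfo 𝒳 ρ ≤ C * Real.sqrt ρ := hsmall ρ h0 (h1.trans (min_le_left _ _))
      _ ≤ C * (R / (C + 1)) := by gcongr
      _ < (C + 1) * (R / (C + 1)) := by gcongr; linarith
      _ = R := by field_simp
  have hdB : d ≤ B := by
    rw [hd, Nat.add_one_le_iff, Nat.floor_lt hfl]
    have : 0 < R / mutualInfo 𝒳 β := by positivity
    nlinarith
  have hch : (0:ℝ) < B.choose d := by exact_mod_cast Nat.choose_pos hdB
  refine TW.limsup_aux _ ((B.choose d : ℝ) * (c₁ * (1 + β) ^ m) ^ d)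
    ((c₂ * (ε / B) ^ m) ^ B) (m * d) (m * B) (by positivity) (by positivity) ?_ ?_
  · filter_upwards [Filter.eventually_gt_atTop 0] with P hP
    have h := TW.pi_upper B d m hm ((1 + β) / P)
      {γ | ∑ b, mutualInfo 𝒳 (ptw P γ b * γ b) < (B : ℝ) * R} (by
        filter_upwards [hopt P hP, TW.ae_nonneg B m hm] with γ h1 h2 h3
        obtain ⟨⟨h11, h12⟩, h13⟩ := h1
        refine (TW.count B (fun b => mutualInfo 𝒳 (ptw P γ b * γ b)) (fun b => ptw P γ b * γ b)
          β (mutualInfo 𝒳 β) R hI hfl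
          (fun b => TW.mi_nonneg 𝒳 hc _ (mul_nonneg (h11 b) (h2 b)))
          (fun b hb => TW.mi_mono 𝒳 _ _ hβ.le hb) h3).trans ?_
        refine Finset.card_le_card fun b hb => ?_
        simp only [Finset.mem_filter, Finset.mem_univ, true_and] at hb ⊢
        exact TW.alloc B β P hβ hP γ (ptw P γ) h2 h11 h12 h13 b hb)
    have h2 := h.trans (mul_le_mul_right (pow_le_pow_left' (hup ((1 + β) / P) (by positivity)) d)
      (B.choose d : ENNReal))
    have h3 := ENNReal.toReal_mono (by finiteness) h2
    refine h3.trans (le_of_eq ?_)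
    rw [ENNReal.toReal_mul, ENNReal.toReal_pow, ENNReal.toReal_ofReal (by positivity),
      ENNReal.toReal_natCast, Real.div_rpow (by positivity) hP.le, mul_assoc, neg_mul_eq_neg_mul,
      Real.rpow_mul hP.le, Real.rpow_natCast, ← mul_pow, Real.rpow_neg hP.le, mul_assoc,
      div_eq_mul_inv]
  · filter_upwards [Filter.eventually_ge_atTop 1] with P hP1
    have hP : 0 < P := by linarith
    have ht1 : ε / B / P ≤ 1 := by
      rw [div_le_one hP]
      refine le_trans ?_ hP1
      rw [div_le_one hB0]
      exact hε1.trans (by exact_mod_cast hB)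
    have h := TW.pi_lower B m hm (ε / B / P)
      {γ | ∑ b, mutualInfo 𝒳 (ptw P γ b * γ b) < (B : ℝ) * R} (by
        filter_upwards [hopt P hP] with γ h1 h2
        obtain ⟨⟨h11, h12⟩, -⟩ := h1
        have hlt : ∑ b : Fin B, mutualInfo 𝒳 (ptw P γ b * γ b) < ∑ b : Fin B, R := by
          refine Finset.sum_lt_sum_of_nonempty ⟨⟨0, hB⟩, Finset.mem_univ _⟩ fun b _ => ?_
          refine hεR _ (mul_nonneg (h11 b) (h2 b).1) ?_
          have hpb : ptw P γ b ≤ B * P :=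
            (Finset.single_le_sum (fun c _ => h11 c) (Finset.mem_univ b)).trans h12
          calc ptw P γ b * γ b ≤ (B * P) * (ε / B / P) :=
                mul_le_mul hpb (h2 b).2 (h2 b).1 (by positivity)
            _ = ε := by field_simp
        simpa using hlt)
    have h2 := (pow_le_pow_left' (hlo (ε / B / P) (by positivity) ht1) B).trans h
    have h3 := ENNReal.toReal_mono (measure_ne_top _ _) h2
    refine le_trans (le_of_eq ?_) h3
    rw [ENNReal.toReal_pow, ENNReal.toReal_ofReal (by positivity),
      Real.div_rpow (by positivity) hP.le, neg_mul_eq_neg_mul,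
      Real.rpow_mul hP.le, Real.rpow_natCast, ← mul_pow, Real.rpow_neg hP.le, mul_assoc,
      div_eq_mul_inv ((ε / (B:ℝ)) ^ m)]
end

section
/- Fix parameters 0 < κ ≤ α/(1+α), α > 0, β > α, a ∈ ℝ with κ·log₂(α) + a = log₂(1+α), and define I^ref(ρ) = log₂(1+ρ) for 0 ≤ ρ ≤ α, I^ref(ρ) = κ·log₂(ρ) + a for α < ρ ≤ β, and I^ref(ρ) = κ·log₂(β) + a for ρ > β. Fix γ₁,…,γ_B > 0 and P > 0. Define p^ref ∈ ℝ₊^B as follows: if Σ_{b=1}^B β/γ_b < B·P, set p^ref_b = β/γ_b; otherwise, for a water level η > 0, set p^ref_b = β/γ_b if η ≥ β/(κγ_b); p^ref_b = κη if α/(κγ_b) ≤ η < β/(κγ_b); p^ref_b = α/γ_b if (α+1)/γ_b ≤ η < α/(κγ_b); p^ref_b = η − 1/γ_b if 1/γ_b ≤ η < (α+1)/γ_b; and p^ref_b = 0 otherwise, where η is chosen so that Σ_{b=1}^B p^ref_b = B·P. Then p^ref attains the maximum of Σ_{b=1}^B I^ref(p_b γ_b) over {p ∈ ℝ₊^B :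 Σ_{b=1}^B p_b ≤ B·P}. -/
open Finset

/-- Refined truncated water-filling surrogate of the mutual information:
`log₂(1+ρ)` for `ρ ≤ α`, the tangent `κ·log₂ ρ + a` for `α < ρ ≤ β`, constant beyond `β`. -/
noncomputable def Iref (κ a α β ρ : ℝ) : ℝ :=
  if ρ ≤ α then Real.logb 2 (1 + ρ)
  else if ρ ≤ β then κ * Real.logb 2 ρ + a
  else κ * Real.logb 2 β + a

lemma aux_log_tan {x y : ℝ} (hx : 0 < x) (hy : 0 < y) :
    Real.log x ≤ Real.log y + (x - y) / y := by
  have h := Real.log_le_sub_one_of_pos (div_pos hx hy)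
  rw [Real.log_div hx.ne' hy.ne'] at h
  have : (x - y) / y = x / y - 1 := by field_simp
  linarith

/-- natural-log version -/
noncomputable def Gref (κ A α β ρ : ℝ) : ℝ :=
  if ρ ≤ α then Real.log (1 + ρ)
  else if ρ ≤ β then κ * Real.log ρ + A
  else κ * Real.log β + A

lemma Iref_eq (κ a α β ρ : ℝ) :
    Iref κ a α β ρ = Gref κ (a * Real.log 2) α β ρ / Real.log 2 := by
  have h2 : Real.log 2 ≠ 0 := (Real.log_pos (by norm_num)).ne'
  unfold Iref Gref Real.logb
  split_ifs <;> field_simp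

section
variable {κ A α β : ℝ}

lemma Gref_le_log (hκ0 : 0 < κ) (hκ : κ ≤ α / (1 + α)) (hα : 0 < α) (hβ : α < β)
    (hA : κ * Real.log α + A = Real.log (1 + α)) {x : ℝ} (hx : 0 ≤ x) :
    Gref κ A α β x ≤ Real.log (1 + x) := by
  have key : ∀ z, α < z → κ * Real.log z + A ≤ Real.log (1 + z) := by
    intro z hz
    have hz0 : 0 < z := hα.trans hz
    have h1 : 0 ≤ Real.log z - Real.log α := sub_nonneg.2 (Real.log_le_log hα hz.le)
    have h2 := mul_le_mul_of_nonneg_right hκ h1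
    have hza : z / α ∈ Set.Ioi (0 : ℝ) := div_pos hz0 hα
    have h1' : (1 : ℝ) ∈ Set.Ioi (0 : ℝ) := by simp
    have w1 : 0 ≤ 1 / (1 + α) := by positivity
    have w2 : 0 ≤ α / (1 + α) := by positivity
    have w3 : 1 / (1 + α) + α / (1 + α) = 1 := by field_simp
    have h3 := strictConcaveOn_log_Ioi.concaveOn.2 h1' hza w1 w2 w3
    simp only [smul_eq_mul, Real.log_one, mul_zero, zero_add, mul_one] at h3
    have h4 : 1 / (1 + α) + α / (1 + α) * (z / α) = (1 + z) / (1 + α) := by field_simp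
    rw [h4, Real.log_div hz0.ne' hα.ne', Real.log_div (by positivity) (by positivity)] at h3
    nlinarith
  unfold Gref
  split_ifs with h1 h2
  · exact le_rfl
  · exact key x (not_le.1 h1)
  · push Not at h1 h2
    exact (key β hβ).trans (Real.log_le_log (by linarith) (by linarith))

lemma Gref_low (hκ0 : 0 < κ) (hα : 0 < α) {x t : ℝ} (hx : 0 ≤ x) (hxa : x ≤ α)
    (ht : α + 1 ≤ t) : Gref κ A α β x ≤ Real.log (1 + α) + (x - α) / t := by
  rw [Gref, if_pos hxa]
  have h := aux_log_tan (x := 1 + x) (y := 1 + α) (by linarith) (by linarith)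
  have : (1 + x - (1 + α)) / (1 + α) ≤ (x - α) / t := by
    rw [div_le_div_iff₀ (by linarith) (by linarith)]
    nlinarith
  linarith

lemma Gref_high (hκ0 : 0 < κ) (hα : 0 < α) (hβ : α < β) {x y : ℝ} (hxa : α < x)
    (hy : 0 < y) : Gref κ A α β x ≤ κ * Real.log y + A + κ * ((x - y) / y) := by
  have h := mul_le_mul_of_nonneg_left (aux_log_tan (hα.trans hxa) hy) hκ0.le
  rw [Gref, if_neg (not_le.2 hxa)]
  split_ifs with h1
  · linarith
  · push Not at h1
    have := mul_le_mul_of_nonneg_left (Real.log_le_log (hα.trans hβ) h1.le) hκ0.le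
    linarith

lemma Gref_mid (hα : 0 < α)
    (hA : κ * Real.log α + A = Real.log (1 + α)) {y : ℝ} (h1 : α ≤ y) (h2 : y ≤ β) :
    Gref κ A α β y = κ * Real.log y + A := by
  rcases h1.eq_or_lt with rfl | h
  · rw [Gref, if_pos le_rfl, hA]
  · rw [Gref, if_neg (not_le.2 h), if_pos h2]

lemma Gref_le_top (hκ0 : 0 < κ) (hα : 0 < α) (hβ : α < β)
    (hA : κ * Real.log α + A = Real.log (1 + α)) {x : ℝ} (hx : 0 ≤ x) :
    Gref κ A α β x ≤ Gref κ A α β β := by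
  rw [Gref_mid hα hA hβ.le le_rfl, Gref]
  have hm := mul_le_mul_of_nonneg_left (Real.log_le_log hα hβ.le) hκ0.le
  split_ifs with h1 h2
  · have := Real.log_le_log (by linarith : 0 < 1 + x) (by linarith : 1 + x ≤ 1 + α)
    linarith
  · have := mul_le_mul_of_nonneg_left
      (Real.log_le_log (hα.trans (not_le.1 h1)) h2) hκ0.le
    linarith
  · exact le_rfl

/-- normalized allocation -/
noncomputable def yref (κ α β t : ℝ) : ℝ :=
  if β ≤ κ * t then β else if α ≤ κ * t then κ * t else if α + 1 ≤ t then α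
  else if 1 ≤ t then t - 1 else 0

lemma Gref_tan (hκ0 : 0 < κ) (hκ : κ ≤ α / (1 + α)) (hα : 0 < α) (hβ : α < β)
    (hA : κ * Real.log α + A = Real.log (1 + α)) {x t : ℝ} (hx : 0 ≤ x) (ht : 0 < t) :
    Gref κ A α β x ≤ Gref κ A α β (yref κ α β t) + (x - yref κ α β t) / t := by
  have hat : α ≤ κ * t → α + 1 ≤ t := by
    intro h
    rw [le_div_iff₀ (by linarith)] at hκ
    have : κ * (1 + α) ≤ κ * t := hκ.trans h
    have := le_of_mul_le_mul_left this hκ0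
    linarith
  -- common argument for the three upper cases
  have mid : ∀ y, α ≤ y → y ≤ β → α + 1 ≤ t → (α < y → y ≤ κ * t) →
      (∀ z, α ≤ z → z ≤ β ∨ κ * t ≤ β → κ * ((z - y) / y) ≤ (z - y) / t) → 
      (y < β ∨ β ≤ κ * t) → (κ * t ≤ β ∨ y = β) →
      Gref κ A α β x ≤ Gref κ A α β y + (x - y) / t := by
    intro y hy1 hy2 ht1 _ hz _ h4
    have hy0 : 0 < y := by linarith
    rw [Gref_mid hα hA hy1 hy2]
    rcases le_or_gt x α with hxa | hxa
    · have h1 := Gref_low (A := A) (β := β) hκ0 hα hx hxa ht1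
      have h2 := mul_le_mul_of_nonneg_left (aux_log_tan hα hy0) hκ0.le
      have h3 := hz α le_rfl (Or.inl hβ.le)
      have : (x - α) / t + (α - y) / t = (x - y) / t := by ring
      linarith
    · rcases le_or_gt x β with hxb | hxb
      · have h1 := Gref_high (A := A) hκ0 hα hβ hxa hy0
        have := hz x hxa.le (Or.inl hxb)
        linarith
      · rcases h4 with h4 | rfl
        · have h1 := Gref_high (A := A) hκ0 hα hβ hxa hy0
          have := hz x hxa.le (Or.inr h4)
          linarith
        · have h1 := Gref_le_top hκ0 hα hβ hA hx
          rw [Gref_mid hα hA hβ.le le_rfl] at h1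
          have : 0 ≤ (x - y) / t := div_nonneg (by linarith) ht.le
          linarith
  unfold yref
  split_ifs with h1 h2 h3 h4
  · apply mid β hβ.le le_rfl (hat (by linarith)) (fun _ => h1) _ (Or.inr h1) (Or.inr rfl)
    intro z _ hz
    have hb : 0 < β := by linarith
    rw [← mul_div_assoc, div_le_div_iff₀ hb ht]
    rcases le_or_gt z β with h | h
    · nlinarith
    · rcases hz with hz | hz
      · linarith
      · have : κ * t = β := le_antisymm hz h1
        rw [← this]; linarith
  · push Not at h1
    apply mid (κ * t) h2 h1.le (hat h2) (fun _ => le_rfl) _ (Or.inl h1) (Or.inl h1.le)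
    intro z _ _
    apply le_of_eq
    field_simp
  · push Not at h1 h2
    apply mid α le_rfl hβ.le h3 (fun h => absurd h (lt_irrefl _)) _ (Or.inl hβ) (Or.inl h1.le)
    intro z hz _
    rw [← mul_div_assoc, div_le_div_iff₀ hα ht]
    nlinarith
  · push Not at h3
    have h := Gref_le_log hκ0 hκ hα hβ hA hx
    have h5 := aux_log_tan (x := 1 + x) (y := t) (by linarith) ht
    have h6 : Gref κ A α β (t - 1) = Real.log t := by
      rw [Gref, if_pos (by linarith)]; congr 1; ring
    have : x - (t - 1) = 1 + x - t := by ring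
    rw [h6, this]; linarith
  · push Not at h4
    have h := Gref_le_log hκ0 hκ hα hβ hA hx
    have h5 := Real.log_le_sub_one_of_pos (by linarith : 0 < 1 + x)
    have h6 : Gref κ A α β 0 = 0 := by
      rw [Gref, if_pos hα.le]; simp
    have : x ≤ (x - 0) / t := by
      rw [le_div_iff₀ ht]; nlinarith
    linarith

lemma yref_nonneg (hκ0 : 0 < κ) (hα : 0 < α) (hβ : α < β) {t : ℝ} (ht : 0 < t) :
    0 ≤ yref κ α β t := by
  unfold yref
  split_ifs <;> first | positivity | linarith

lemma alloc_eq (hκ0 : 0 < κ) {g η : ℝ} (hg : 0 < g) :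
    (if β / (κ * g) ≤ η then β / g
        else if α / (κ * g) ≤ η then κ * η
        else if (α + 1) / g ≤ η then α / g
        else if 1 / g ≤ η then η - 1 / g
        else 0) = yref κ α β (g * η) / g := by
  have e : ∀ c, c / (κ * g) ≤ η ↔ c ≤ κ * (g * η) := by
    intro c
    rw [div_le_iff₀ (by positivity)]
    constructor <;> intro h <;> linarith
  have e' : ∀ c, c / g ≤ η ↔ c ≤ g * η := by
    intro c
    rw [div_le_iff₀ hg, mul_comm]
  simp only [e, e', yref]
  split_ifs <;> field_simp
  simp
end

/-- the refined truncated water-filling allocation maximizes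
`∑ I^ref(p_b γ_b)` over `{p ∈ ℝ₊^B : ∑ p_b ≤ B·P}`. -/
theorem refined_truncated_waterfilling_maximizes_Iref
    (B : ℕ) (hB : 1 ≤ B) (κ a α β : ℝ)
    (hκ0 : 0 < κ) (hκ : κ ≤ α / (1 + α)) (hα : 0 < α) (hβ : α < β)
    (ha : κ * Real.logb 2 α + a = Real.logb 2 (1 + α))
    (γ : Fin B → ℝ) (hγ : ∀ b, 0 < γ b) (P : ℝ) (hP : 0 < P)
    (η : ℝ)
    (hη : ¬ (∑ b, β / γ b < (B : ℝ) * P) →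
      0 < η ∧
        ∑ b, (if β / (κ * γ b) ≤ η then β / γ b
          else if α / (κ * γ b) ≤ η then κ * η
          else if (α + 1) / γ b ≤ η then α / γ b
          else if 1 / γ b ≤ η then η - 1 / γ b
          else 0) = (B : ℝ) * P)
    (pref : Fin B → ℝ)
    (hpref : pref = if ∑ b, β / γ b < (B : ℝ) * P then (fun b => β / γ b)
      else fun b =>
        if β / (κ * γ b) ≤ η then β / γ b
        else if α / (κ * γ b) ≤ η then κ * η
        else if (α + 1) / γ b ≤ η then α / γ b
        else if 1 / γ b ≤ η then η - 1 / γ b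
        else 0) :
    (∀ b, 0 ≤ pref b) ∧ (∑ b, pref b ≤ (B : ℝ) * P) ∧
    ∀ p : Fin B → ℝ, (∀ b, 0 ≤ p b) → ∑ b, p b ≤ (B : ℝ) * P →
      ∑ b, Iref κ a α β (p b * γ b) ≤ ∑ b, Iref κ a α β (pref b * γ b) := by
  have hl2 : 0 < Real.log 2 := Real.log_pos (by norm_num)
  have hA : κ * Real.log α + a * Real.log 2 = Real.log (1 + α) := by
    unfold Real.logb at ha
    field_simp at ha
    linarith
  simp only [Iref_eq, ← Finset.sum_div]
  by_cases hc : ∑ b, β / γ b < (B : ℝ) * P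
  · rw [if_pos hc] at hpref
    subst hpref
    refine ⟨fun b => div_nonneg (by linarith) (hγ b).le, hc.le, fun p hp _ => ?_⟩
    gcongr with b
    rw [div_mul_cancel₀ _ (hγ b).ne']
    exact Gref_le_top hκ0 hα hβ hA (mul_nonneg (hp b) (hγ b).le)
  · rw [if_neg hc] at hpref
    obtain ⟨h0, hs⟩ := hη hc
    have hp' : ∀ b, pref b = yref κ α β (γ b * η) / γ b := by
      intro b
      rw [hpref]
      exact alloc_eq hκ0 (hγ b)
    have hs' : ∑ b, pref b = (B : ℝ) * P := by rw [hpref]; exact hs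
    refine ⟨fun b => ?_, hs'.le, fun p hp hps => ?_⟩
    · rw [hp']
      exact div_nonneg (yref_nonneg hκ0 hα hβ (mul_pos (hγ b) h0)) (hγ b).le
    · gcongr ?_ / _
      have hb : ∀ b ∈ Finset.univ, Gref κ (a * Real.log 2) α β (p b * γ b) ≤
          Gref κ (a * Real.log 2) α β (pref b * γ b) + (p b - pref b) / η := by
        intro b _
        have h := Gref_tan hκ0 hκ hα hβ hA (mul_nonneg (hp b) (hγ b).le)
          (mul_pos (hγ b) h0)
        have hy : yref κ α β (γ b * η) = pref b * γ b := by
          rw [hp', div_mul_cancel₀ _ (hγ b).ne']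
        rw [hy] at h
        have e : (p b * γ b - pref b * γ b) / (γ b * η) = (p b - pref b) / η := by
          have := (hγ b).ne'
          field_simp
        rwa [e] at h
      have h := Finset.sum_le_sum hb
      rw [Finset.sum_add_distrib, ← Finset.sum_div, Finset.sum_sub_distrib, hs'] at h
      have : (∑ b, p b - (B : ℝ) * P) / η ≤ 0 :=
        div_nonpos_of_nonpos_of_nonneg (by linarith) h0.le
      linarith
end

section
/- Let (Ω, μ) be a probability space, φ : Ω → [0,∞) a measurable function, and P a real number with 0 < P < ∫ φ dμ (the integral possibly infinite). Define P(s) = ∫_{{φ < s}} φ dμ and P̄(s) = ∫_{{φ ≤ s}} φ dμ for s ≥ 0, and s* = sup{s ≥ 0 : P(s) < P}. Then s* is finite and P(s*) ≤ P ≤ P̄(s*). Consequently, the randomization weight w* = (P − P(s*))/(P̄(s*) − P(s*)) lies in [0,1] whenever P̄(s*) > P(s*), and the long-term scheme that transmits with average power φ(γ) on {φ < s*}, transmits with probability w* on {φ = s*}, and is silent on {φ > s*} consumes exactly long-term power P(s*) + w*(P̄(s*) − P(s*)) = P. -/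
open MeasureTheory

/-- for a probability space `(Ω, μ)`, measurable `φ ≥ 0` and
`0 < P < ∫φ dμ` (possibly infinite integral), with `P(s) = ∫_{φ<s} φ`, `P̄(s) = ∫_{φ≤s} φ`
and `s* = sup{s ≥ 0 : P(s) < P}`: the sup defining `s*` is over a bounded (hence `s*` is
finite) set, `P(s*) ≤ P ≤ P̄(s*)`, and whenever `P̄(s*) > P(s*)` the randomization weight
`w* = (P − P(s*))/(P̄(s*) − P(s*))` lies in `[0,1]` and the consumed long-term power is
`P(s*) + w*(P̄(s*) − P(s*)) = P`. -/
theorem longTerm_threshold_and_randomization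
    {Ω : Type*} [MeasurableSpace Ω] (μ : Measure Ω) [IsProbabilityMeasure μ]
    (φ : Ω → ℝ) (hφ : Measurable φ) (hφ0 : ∀ ω, 0 ≤ φ ω)
    (P : ℝ) (hP : 0 < P)
    (hPlt : ENNReal.ofReal P < ∫⁻ ω, ENNReal.ofReal (φ ω) ∂μ)
    (Ps Pbar : ℝ → ENNReal)
    (hPs : Ps = fun s => ∫⁻ ω in {ω | φ ω < s}, ENNReal.ofReal (φ ω) ∂μ)
    (hPbar : Pbar = fun s => ∫⁻ ω in {ω | φ ω ≤ s}, ENNReal.ofReal (φ ω) ∂μ)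
    (sstar : ℝ) (hsstar : sstar = sSup {s : ℝ | 0 ≤ s ∧ Ps s < ENNReal.ofReal P}) :
    BddAbove {s : ℝ | 0 ≤ s ∧ Ps s < ENNReal.ofReal P} ∧
    Ps sstar ≤ ENNReal.ofReal P ∧ ENNReal.ofReal P ≤ Pbar sstar ∧
    (Ps sstar < Pbar sstar →
      (0 ≤ (P - (Ps sstar).toReal) / ((Pbar sstar).toReal - (Ps sstar).toReal)) ∧
      ((P - (Ps sstar).toReal) / ((Pbar sstar).toReal - (Ps sstar).toReal) ≤ 1) ∧
      (Ps sstar).toReal +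
        ((P - (Ps sstar).toReal) / ((Pbar sstar).toReal - (Ps sstar).toReal)) *
          ((Pbar sstar).toReal - (Ps sstar).toReal) = P) := by
  
  set ν := μ.withDensity (fun ω => ENNReal.ofReal (φ ω)) with hν
  have hmlt : ∀ s : ℝ, MeasurableSet {ω | φ ω < s} := fun s => measurableSet_lt hφ measurable_const
  have hmle : ∀ s : ℝ, MeasurableSet {ω | φ ω ≤ s} := fun s => measurableSet_le hφ measurable_const
  have ePs : ∀ s, Ps s = ν {ω | φ ω < s} := fun s => by
    rw [hPs, hν, withDensity_apply _ (hmlt s)]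
  have ePb : ∀ s, Pbar s = ν {ω | φ ω ≤ s} := fun s => by
    rw [hPbar, hν, withDensity_apply _ (hmle s)]
  have huniv : ENNReal.ofReal P < ν Set.univ := by
    rw [hν, withDensity_apply _ MeasurableSet.univ, Measure.restrict_univ]; exact hPlt
  have hmono : Monotone Ps := fun a b hab => by
    rw [ePs, ePs]
    exact measure_mono (fun ω (h : φ ω < a) => lt_of_lt_of_le h hab)
  have hfin : ∀ s, Pbar s < ⊤ := fun s => by
    rw [hPbar]
    calc ∫⁻ ω in {ω | φ ω ≤ s}, ENNReal.ofReal (φ ω) ∂μ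
        ≤ ∫⁻ ω in {ω | φ ω ≤ s}, ENNReal.ofReal s ∂μ :=
          setLIntegral_mono measurable_const (fun ω h => ENNReal.ofReal_le_ofReal h)
      _ < ⊤ := by
          rw [setLIntegral_const]
          exact ENNReal.mul_lt_top ENNReal.ofReal_lt_top (measure_lt_top _ _)
  have hle : ∀ s, Ps s ≤ Pbar s := fun s => by
    rw [ePs, ePb]
    exact measure_mono (fun ω (h : φ ω < s) => le_of_lt h)
  set S := {s : ℝ | 0 ≤ s ∧ Ps s < ENNReal.ofReal P} with hS
  have hbdd : BddAbove S := by
    have hU : (⋃ n : ℕ, {ω | φ ω < (n : ℝ)}) = Set.univ := by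
      ext ω; simpa using exists_nat_gt (φ ω)
    have hm : Monotone (fun n : ℕ => {ω | φ ω < (n : ℝ)}) := fun a b hab ω (h : φ ω < a) =>
      lt_of_lt_of_le h (Nat.cast_le.mpr hab)
    rw [← hU, hm.measure_iUnion] at huniv
    obtain ⟨n, hn⟩ := lt_iSup_iff.mp huniv
    refine ⟨n, fun s hs => ?_⟩
    by_contra! hlt
    have h1 := hmono hlt.le
    rw [ePs n] at h1
    exact absurd (hn.trans_le h1) (not_lt.mpr hs.2.le)
  have h0 : (0 : ℝ) ∈ S := by
    refine ⟨le_rfl, ?_⟩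
    have : {ω | φ ω < 0} = ∅ := by
      ext ω; simpa using hφ0 ω
    rw [ePs, this, measure_empty]
    exact ENNReal.ofReal_pos.mpr hP
  have hs0 : 0 ≤ sstar := hsstar ▸ le_csSup hbdd h0
  have h1 : Ps sstar ≤ ENNReal.ofReal P := by
    have hU : (⋃ n : ℕ, {ω | φ ω < sstar - 1 / ((n : ℝ) + 1)}) = {ω | φ ω < sstar} := by
      ext ω
      simp only [Set.mem_iUnion, Set.mem_setOf_eq]
      constructor
      · rintro ⟨n, hn⟩
        have : 0 < 1 / ((n : ℝ) + 1) := by positivity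
        linarith
      · intro h
        obtain ⟨n, hn⟩ := exists_nat_one_div_lt (sub_pos.mpr h)
        exact ⟨n, by linarith⟩
    have hm : Monotone (fun n : ℕ => {ω | φ ω < sstar - 1 / ((n : ℝ) + 1)}) :=
      fun a b hab ω (h : φ ω < _) =>
      lt_of_lt_of_le h (sub_le_sub_left (Nat.one_div_le_one_div hab) _)
    rw [ePs, ← hU, hm.measure_iUnion]
    refine iSup_le fun n => ?_
    have hpos : 0 < 1 / ((n : ℝ) + 1) := by positivity
    have hlt : sstar - 1 / ((n : ℝ) + 1) < sSup S := by rw [← hsstar]; linarith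
    obtain ⟨s, hs, hlt⟩ := exists_lt_of_lt_csSup ⟨0, h0⟩ hlt
    rw [← ePs]
    exact (hmono hlt.le).trans hs.2.le
  have h2 : ENNReal.ofReal P ≤ Pbar sstar := by
    have hI : (⋂ n : ℕ, {ω | φ ω < sstar + 1 / ((n : ℝ) + 1)}) = {ω | φ ω ≤ sstar} := by
      ext ω
      simp only [Set.mem_iInter, Set.mem_setOf_eq]
      constructor
      · intro h
        by_contra! hlt
        obtain ⟨n, hn⟩ := exists_nat_one_div_lt (sub_pos.mpr hlt)
        linarith [h n]
      · intro h n
        have : 0 < 1 / ((n : ℝ) + 1) := by positivity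
        linarith
    have hm : Antitone (fun n : ℕ => {ω | φ ω < sstar + 1 / ((n : ℝ) + 1)}) :=
      fun a b hab ω (h : φ ω < _) =>
      lt_of_lt_of_le h (by gcongr)
    rw [ePb, ← hI, hm.measure_iInter (fun n => (hmlt _).nullMeasurableSet)
      ⟨0, by rw [← ePs]; exact ((hle _).trans_lt (hfin _)).ne⟩]
    refine le_iInf fun n => ?_
    have hpos : 0 < 1 / ((n : ℝ) + 1) := by positivity
    rw [← ePs]
    by_contra! hlt
    have : sstar + 1 / ((n : ℝ) + 1) ≤ sSup S := le_csSup hbdd ⟨by linarith, hlt⟩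
    rw [← hsstar] at this
    linarith
  refine ⟨hbdd, h1, h2, fun hlt => ?_⟩
  have hd : (Ps sstar).toReal < (Pbar sstar).toReal :=
    (ENNReal.toReal_lt_toReal hlt.ne_top (hfin _).ne).mpr hlt
  have ha : (Ps sstar).toReal ≤ P := ENNReal.toReal_le_of_le_ofReal hP.le h1
  have hb : P ≤ (Pbar sstar).toReal := (ENNReal.ofReal_le_iff_le_toReal (hfin _).ne).mp h2
  have hd' : 0 < (Pbar sstar).toReal - (Ps sstar).toReal := sub_pos.mpr hd
  refine ⟨div_nonneg (by linarith) hd'.le, (div_le_one hd').mpr (by linarith), ?_⟩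
  rw [div_mul_cancel₀ _ hd'.ne']
  ring
end

section
/- Fix β > 0, γ₁,…,γ_B > 0, and a rate R with 0 < R ≤ log₂(1+β). Let I^tw(ρ) = min{log₂(1+ρ), log₂(1+β)} and suppose η > 0 is such that the vector ℘ with ℘_b = min{β/γ_b, (η − 1/γ_b)₊} satisfies Σ_{b=1}^B log₂(1 + ℘_b γ_b) = B·R, where x₊ = max{x,0}. Then ℘ attains the minimum of ⟨℘'⟩ = (1/B)Σ_{b=1}^B ℘'_b over the set {℘' ∈ ℝ₊^B : Σ_{b=1}^B I^tw(℘'_b γ_b) ≥ B·R}; that is, truncated water-filling is the minimum-power allocation achieving rate R under the surrogate mutual information I^tw. -/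
open Finset

lemma key_aux (β g η w v : ℝ) (hβ : 0 < β) (hg : 0 < g) (hη : 0 < η)
    (hw : w = min (β / g) (max (η - 1 / g) 0)) (hv : 0 ≤ v) :
    0 ≤ w ∧ w * g ≤ β ∧
    η * Real.log 2 * (Itw β (v * g) - Real.logb 2 (1 + w * g)) ≤ v - w := by
  have hw0 : 0 ≤ w := by rw [hw]; positivity
  have hwb : w * g ≤ β := by
    rw [← le_div_iff₀ hg, hw]; exact min_le_left _ _
  refine ⟨hw0, hwb, ?_⟩
  have h2 : 0 < Real.log 2 := Real.log_pos (by norm_num)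
  have hwg : 0 ≤ w * g := by positivity
  obtain ⟨r, hr0, hrb, hrv, hI⟩ : ∃ r, 0 ≤ r ∧ r ≤ β ∧ r ≤ v * g ∧
      Itw β (v * g) = Real.logb 2 (1 + r) := by
    unfold Itw
    split_ifs with h
    · exact ⟨v * g, by positivity, h, le_rfl, rfl⟩
    · exact ⟨β, hβ.le, le_rfl, (not_le.mp h).le, rfl⟩
  have e : η * Real.log 2 * (Itw β (v * g) - Real.logb 2 (1 + w * g))
      = η * Real.log ((1 + r) / (1 + w * g)) := by
    rw [hI, Real.log_div (by positivity) (by positivity)]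
    unfold Real.logb
    field_simp
  rw [e]
  have hl : Real.log ((1 + r) / (1 + w * g)) ≤ (1 + r) / (1 + w * g) - 1 :=
    Real.log_le_sub_one_of_pos (by positivity)
  refine (mul_le_mul_of_nonneg_left hl hη.le).trans ?_
  have e2 : η * ((1 + r) / (1 + w * g) - 1) = η * (r - w * g) / (1 + w * g) := by
    field_simp
    ring
  rw [e2, div_le_iff₀ (by positivity)]
  have hgi : 1 / g * g = 1 := by field_simp
  have hbi : β / g * g = β := by field_simp
  rcases min_choice (β / g) (max (η - 1 / g) 0) with h | h
  · have hle : w ≤ max (η - 1 / g) 0 := by rw [hw]; exact min_le_right _ _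
    rw [h] at hw
    have hwβ : w * g = β := by rw [hw, hbi]
    have hwpos : 0 < w := by rw [hw]; positivity
    have h3 : w ≤ η - 1 / g := by
      rcases le_max_iff.mp hle with h | h
      · exact h
      · linarith
    have h4 : 1 + w * g ≤ η * g := by nlinarith
    have h5 : η * (r - w * g) * g ≤ (v - w) * (1 + w * g) * g := by
      nlinarith [mul_nonneg (sub_nonneg.2 h4) (by linarith : 0 ≤ w * g - r),
        mul_nonneg (by linarith : 0 ≤ v * g - r) (by linarith : 0 ≤ 1 + w * g)]
    exact le_of_mul_le_mul_right h5 hg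
  · rw [h] at hw
    rcases max_choice (η - 1 / g) 0 with h' | h'
    · rw [h'] at hw
      have h4 : 1 + w * g = η * g := by rw [hw]; linarith
      rw [h4]
      nlinarith
    · have h6 : η - 1 / g ≤ 0 := by rw [← h']; exact le_max_left _ _
      rw [h'] at hw
      subst hw
      have h4 : η * g ≤ 1 := by nlinarith
      nlinarith

/-- the truncated water-filling vector `℘_b = min{β/γ_b, (η − 1/γ_b)₊}`, with
water level `η > 0` chosen so that `∑ log₂(1 + ℘_b γ_b) = B·R`, minimizes the per-codeword
average power `(1/B)∑ ℘'_b` over `{℘' ∈ ℝ₊^B : ∑ I^tw(℘'_b γ_b) ≥ B·R}`. -/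
theorem longTerm_truncated_waterfilling_min_power
    (B : ℕ) (hB : 1 ≤ B) (β : ℝ) (hβ : 0 < β)
    (γ : Fin B → ℝ) (hγ : ∀ b, 0 < γ b)
    (R : ℝ) (hR : 0 < R) (hRβ : R ≤ Real.logb 2 (1 + β))
    (η : ℝ) (hη : 0 < η)
    (w : Fin B → ℝ) (hw : w = fun b => min (β / γ b) (max (η - 1 / γ b) 0))
    (hrate : ∑ b, Real.logb 2 (1 + w b * γ b) = (B : ℝ) * R) :
    (∀ b, 0 ≤ w b) ∧
    ((B : ℝ) * R ≤ ∑ b, Itw β (w b * γ b)) ∧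
    ∀ v : Fin B → ℝ, (∀ b, 0 ≤ v b) → (B : ℝ) * R ≤ ∑ b, Itw β (v b * γ b) →
      (B : ℝ)⁻¹ * ∑ b, w b ≤ (B : ℝ)⁻¹ * ∑ b, v b := by
  have K := fun b (x : ℝ) (hx : 0 ≤ x) =>
    key_aux β (γ b) η (w b) x hβ (hγ b) hη (by rw [hw]) hx
  refine ⟨fun b => (K b 0 le_rfl).1, ?_, ?_⟩
  · rw [← hrate]
    refine Finset.sum_le_sum fun b _ => ?_
    unfold Itw
    rw [if_pos (K b 0 le_rfl).2.1]
  · intro v hv hvr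
    refine mul_le_mul_of_nonneg_left ?_ (by positivity)
    have h := Finset.sum_le_sum fun b (_ : b ∈ Finset.univ) => (K b (v b) (hv b)).2.2
    rw [← Finset.mul_sum, Finset.sum_sub_distrib, Finset.sum_sub_distrib, hrate] at h
    have h2 : 0 < Real.log 2 := Real.log_pos (by norm_num)
    have := mul_nonneg (mul_pos hη h2).le (sub_nonneg.2 hvr)
    linarith
end

section
/- Fix parameters 0 < κ ≤ α/(1+α), α > 0, β > α, a ∈ ℝ with κ·log₂(α) + a = log₂(1+α), and define I^ref(ρ) = log₂(1+ρ) for 0 ≤ ρ ≤ α, I^ref(ρ) = κ·log₂(ρ) + a for α < ρ ≤ β, and I^ref(ρ) = κ·log₂(β) + a for ρ > β. Fix γ₁,…,γ_B > 0 and a rate R with 0 < R ≤ κ·log₂(β) + a. Suppose η > 0 is such that the vector ℘ defined by ℘_b = β/γ_b if η ≥ β/(κγ_b); ℘_b = κη if α/(κγ_b) ≤ η ≤ β/(κγ_b); ℘_b = α/γ_b if (α+1)/γ_b ≤ η ≤ α/(κγ_b); ℘_b = η − 1/γ_b if 1/γ_b ≤ η ≤ (α+1)/γ_b; and ℘_b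 = 0 otherwise, satisfies Σ_{b=1}^B I^ref(℘_b γ_b) = B·R. Then ℘ attains the minimum of ⟨℘'⟩ = (1/B)Σ_{b=1}^B ℘'_b over the set {℘' ∈ ℝ₊^B : Σ_{b=1}^B I^ref(℘'_b γ_b) ≥ B·R}. -/
open Finset

theorem aux_log (c x y t : ℝ) (hc : 0 < c) (hx : 0 < x) (hy : 0 < y) (ht : 0 < t)
    (h : c * t * (x - y) ≤ y * (x - y)) :
    (c * Real.log x - c * Real.log y) * t ≤ x - y := by
  have h1 : Real.log (x / y) ≤ x / y - 1 := Real.log_le_sub_one_of_pos (div_pos hx hy)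
  rw [Real.log_div hx.ne' hy.ne'] at h1
  have h2 : x / y - 1 = (x - y) / y := by field_simp
  rw [h2] at h1
  have h3 : (c * t) * (Real.log x - Real.log y) ≤ (c * t) * ((x - y) / y) :=
    mul_le_mul_of_nonneg_left h1 (by positivity)
  have h4 : (c * t) * ((x - y) / y) ≤ x - y := by
    rw [← mul_div_assoc, div_le_iff₀ hy]; linarith
  linarith

noncomputable def Jn (κ a α β ρ : ℝ) : ℝ :=
  if ρ ≤ α then Real.log (1 + ρ)
  else if ρ ≤ β then κ * Real.log ρ + a
  else κ * Real.log β + a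

theorem Iref_mul (κ a α β ρ : ℝ) :
    Iref κ a α β ρ = Jn κ (a * Real.log 2) α β ρ / Real.log 2 := by
  have : Real.log 2 ≠ 0 := (Real.log_pos (by norm_num)).ne'
  unfold Iref Jn Real.logb
  split_ifs <;> field_simp

theorem Jn_key (κ a α β t s ρ : ℝ) (hκ0 : 0 < κ) (hκ : κ * (1 + α) ≤ α) (hα : 0 < α) (hβ : α < β)
    (ha : κ * Real.log α + a = Real.log (1 + α)) (ht : 0 < t) (hρ : 0 ≤ ρ)
    (hs : (β ≤ κ * t ∧ s = β) ∨ (α ≤ κ * t ∧ κ * t < β ∧ s = κ * t) ∨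
      (α + 1 ≤ t ∧ κ * t < α ∧ s = α) ∨ (1 ≤ t ∧ t < α + 1 ∧ s = t - 1) ∨ (t < 1 ∧ s = 0)) :
    (Jn κ a α β ρ - Jn κ a α β s) * t ≤ ρ - s := by
  have low : ∀ x y : ℝ, 0 ≤ x → 0 ≤ y → t * (x - y) ≤ (1 + y) * (x - y) →
      (Real.log (1 + x) - Real.log (1 + y)) * t ≤ x - y := by
    intro x y hx hy h
    have := aux_log 1 (1 + x) (1 + y) t one_pos (by linarith) (by linarith) ht (by linarith)
    linarith
  have mid : ∀ x y : ℝ, 0 < x → 0 < y → κ * t * (x - y) ≤ y * (x - y) →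
      (κ * Real.log x - κ * Real.log y) * t ≤ x - y :=
    fun x y hx hy h => aux_log κ x y t hκ0 hx hy ht h
  have hβ0 : 0 < β := hα.trans hβ
  -- values of J
  have Jlow : ∀ x, x ≤ α → Jn κ a α β x = Real.log (1 + x) := fun x h => by simp [Jn, h]
  have Jmid : ∀ x, α ≤ x → x ≤ β → Jn κ a α β x = κ * Real.log x + a := by
    intro x h1 h2
    rcases h1.eq_or_lt with h | h
    · rw [← h, Jlow _ le_rfl, ha]
    · simp [Jn, not_le.mpr h, h2]
  have Jhigh : ∀ x, β < x → Jn κ a α β x = κ * Real.log β + a := by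
    intro x h
    simp [Jn, not_le.mpr h, not_le.mpr (hβ.trans h)]
  -- it suffices to treat ρ ≤ β
  suffices H : ∀ r, 0 ≤ r → r ≤ β → (Jn κ a α β r - Jn κ a α β s) * t ≤ r - s by
    rcases le_or_gt ρ β with h | h
    · exact H ρ hρ h
    · have := H β hβ0.le le_rfl
      rw [Jhigh ρ h, ← Jmid β hβ.le le_rfl]
      linarith
  intro r hr hrβ
  rcases hs with ⟨h1, rfl⟩ | ⟨h1, h2, rfl⟩ | ⟨h1, h2, rfl⟩ | ⟨h1, h2, rfl⟩ | ⟨h1, rfl⟩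
  · have hts : 1 + α ≤ t := by
      by_contra hc
      push Not at hc
      nlinarith
    rw [Jmid s hβ.le le_rfl]
    rcases le_total r α with h | h
    · rw [Jlow r h]
      have e1 := low r α hr hα.le (by nlinarith)
      have e2 := mid α s hα hβ0 (by nlinarith)
      rw [← ha] at e1
      linarith
    · rw [Jmid r h hrβ]
      have e2 := mid r s (by linarith) hβ0 (by nlinarith)
      linarith
  · have hts : 1 + α ≤ t := by
      by_contra hc
      push Not at hc
      nlinarith
    rw [Jmid _ h1 h2.le]
    rcases le_total r α with h | h
    · rw [Jlow r h]
      have e1 := low r α hr hα.le (by nlinarith)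
      have e2 := mid α (κ * t) hα (by positivity) le_rfl
      rw [← ha] at e1
      linarith
    · rw [Jmid r h hrβ]
      have e2 := mid r (κ * t) (by linarith) (by positivity) le_rfl
      linarith
  · rcases le_total r s with h | h
    · rw [Jlow r h, Jlow s le_rfl]
      exact low r s hr hα.le (by nlinarith)
    · rw [Jmid r h hrβ, Jmid s le_rfl hβ.le]
      have e2 := mid r s (by linarith) hα (by nlinarith)
      linarith
  · have hkt : κ * t ≤ α := by nlinarith
    rw [Jlow (t - 1) (by linarith)]
    rcases le_total r α with h | h
    · rw [Jlow r h]
      exact low r (t - 1) hr (by linarith) (by linarith)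
    · rw [Jmid r h hrβ]
      have e1 := low α (t - 1) hα.le (by linarith) (by linarith)
      have e2 := mid r α (by linarith) hα (by nlinarith)
      rw [← ha] at e1
      linarith
  · have hkt : κ * t ≤ α := by nlinarith
    rw [Jlow 0 hα.le]
    rcases le_total r α with h | h
    · rw [Jlow r h]
      exact low r 0 hr le_rfl (by nlinarith)
    · rw [Jmid r h hrβ]
      have e1 := low α 0 hα.le le_rfl (by nlinarith)
      have e2 := mid r α (by linarith) hα (by nlinarith)
      rw [← ha] at e1
      linarith

/-- the refined truncated water-filling vector `℘`, determined by the water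
level `η > 0` through the stated case distinction and satisfying the rate constraint
`∑ I^ref(℘_b γ_b) = B·R`, minimizes the per-codeword average power `(1/B)∑ ℘'_b` over
`{℘' ∈ ℝ₊^B : ∑ I^ref(℘'_b γ_b) ≥ B·R}`. -/
theorem longTerm_refined_truncated_waterfilling_min_power
    (B : ℕ) (hB : 1 ≤ B) (κ a α β : ℝ)
    (hκ0 : 0 < κ) (hκ : κ ≤ α / (1 + α)) (hα : 0 < α) (hβ : α < β)
    (ha : κ * Real.logb 2 α + a = Real.logb 2 (1 + α))
    (γ : Fin B → ℝ) (hγ : ∀ b, 0 < γ b)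
    (R : ℝ) (hR : 0 < R) (hRβ : R ≤ κ * Real.logb 2 β + a)
    (η : ℝ) (hη : 0 < η)
    (w : Fin B → ℝ)
    (hw : w = fun b =>
      if β / (κ * γ b) ≤ η then β / γ b
      else if α / (κ * γ b) ≤ η then κ * η
      else if (α + 1) / γ b ≤ η then α / γ b
      else if 1 / γ b ≤ η then η - 1 / γ b
      else 0)
    (hrate : ∑ b, Iref κ a α β (w b * γ b) = (B : ℝ) * R) :
    (∀ b, 0 ≤ w b) ∧
    ((B : ℝ) * R ≤ ∑ b, Iref κ a α β (w b * γ b)) ∧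
    ∀ v : Fin B → ℝ, (∀ b, 0 ≤ v b) → (B : ℝ) * R ≤ ∑ b, Iref κ a α β (v b * γ b) →
      (B : ℝ)⁻¹ * ∑ b, w b ≤ (B : ℝ)⁻¹ * ∑ b, v b := by
  have hl2 : 0 < Real.log 2 := Real.log_pos (by norm_num)
  have hβ0 : 0 < β := hα.trans hβ
  have hκ' : κ * (1 + α) ≤ α := by rwa [le_div_iff₀ (by linarith)] at hκ
  have ha' : κ * Real.log α + a * Real.log 2 = Real.log (1 + α) := by
    unfold Real.logb at ha
    field_simp at ha
    linarith
  have hcase : ∀ b, 0 ≤ w b ∧ ((β ≤ κ * (η * γ b) ∧ w b * γ b = β) ∨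
      (α ≤ κ * (η * γ b) ∧ κ * (η * γ b) < β ∧ w b * γ b = κ * (η * γ b)) ∨
      (α + 1 ≤ η * γ b ∧ κ * (η * γ b) < α ∧ w b * γ b = α) ∨
      (1 ≤ η * γ b ∧ η * γ b < α + 1 ∧ w b * γ b = η * γ b - 1) ∨
      (η * γ b < 1 ∧ w b * γ b = 0)) := by
    intro b
    have hg := hγ b
    have hkg : 0 < κ * γ b := mul_pos hκ0 hg
    have e : κ * (η * γ b) = η * (κ * γ b) := by ring
    rw [hw, e]
    simp only [div_le_iff₀ hkg, div_le_iff₀ hg]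
    split_ifs with h1 h2 h3 h4
    · exact ⟨by positivity, Or.inl ⟨h1, by field_simp⟩⟩
    · exact ⟨by positivity, Or.inr (Or.inl ⟨h2, not_le.mp h1, by ring⟩)⟩
    · exact ⟨by positivity, Or.inr (Or.inr (Or.inl ⟨h3, not_le.mp h2, by field_simp⟩))⟩
    · refine ⟨?_, Or.inr (Or.inr (Or.inr (Or.inl ⟨h4, not_le.mp h3, by field_simp⟩)))⟩
      rw [sub_nonneg, div_le_iff₀ hg]
      exact h4
    · exact ⟨le_rfl, Or.inr (Or.inr (Or.inr (Or.inr ⟨not_le.mp h4, by ring⟩)))⟩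
  refine ⟨fun b => (hcase b).1, hrate.ge, ?_⟩
  intro v hv hvr
  apply mul_le_mul_of_nonneg_left _ (by positivity)
  have key : ∀ b, (Iref κ a α β (v b * γ b) - Iref κ a α β (w b * γ b)) * (η * Real.log 2)
      ≤ v b - w b := by
    intro b
    have hg := hγ b
    have h := Jn_key κ (a * Real.log 2) α β (η * γ b) (w b * γ b) (v b * γ b) hκ0 hκ' hα hβ ha'
      (mul_pos hη hg) (mul_nonneg (hv b) hg.le) (hcase b).2
    rw [Iref_mul, Iref_mul, ← sub_div]
    refine le_of_mul_le_mul_right ?_ hg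
    calc _ = (Jn κ (a * Real.log 2) α β (v b * γ b) - Jn κ (a * Real.log 2) α β (w b * γ b))
          * (η * γ b) := by field_simp
      _ ≤ _ := h
      _ = _ := by ring
  have hsum := Finset.sum_le_sum (fun b (_ : b ∈ Finset.univ) => key b)
  rw [← Finset.sum_mul, Finset.sum_sub_distrib, Finset.sum_sub_distrib] at hsum
  have : 0 ≤ (∑ b, Iref κ a α β (v b * γ b) - ∑ b, Iref κ a α β (w b * γ b)) *
      (η * Real.log 2) := mul_nonneg (by linarith) (by positivity)
  linarith
end
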